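/- arXiv:2008.12698 — 7 statements merged into one kernel-verified Lean document; each statement's English description precedes it below -/
import Mathlib

section
/- Haviland's theorem: Let K be a closed subset of ℝ^d and let L be a linear functional on the real polynomial algebra ℝ[x₁,…,x_d]. Then L(p) ≥ 0 for every polynomial p with p(x) ≥ 0 for all x ∈ K if and only if there exists a Radon measure μ on ℝ^d with support contained in K such that every polynomial is μ-integrable and L(p) = ∫ p dμ for all p ∈ ℝ[x₁,…,x_d]. -/
open MeasureTheory

/-- A Radon measure: finite on compact sets and inner regular with respect to compact sets. -/
def IsRadon {X : Type*} [TopologicalSpace X] [MeasurableSpace X] (μ : Measure X) : Prop :=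
  IsFiniteMeasureOnCompacts μ ∧ μ.InnerRegular

open CompactlySupportedContinuousMap in
lemma hav_ext (d : ℕ) (K : Set (Fin d → ℝ)) (L : MvPolynomial (Fin d) ℝ →ₗ[ℝ] ℝ)
    (hL : ∀ p : MvPolynomial (Fin d) ℝ, (∀ x ∈ K, 0 ≤ MvPolynomial.eval x p) → 0 ≤ L p) :
    ∃ Λ : CompactlySupportedContinuousMap (Fin d → ℝ) ℝ →ₗ[ℝ] ℝ,
      ∀ (p : MvPolynomial (Fin d) ℝ) (f : CompactlySupportedContinuousMap (Fin d → ℝ) ℝ),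
        (∀ x ∈ K, 0 ≤ MvPolynomial.eval x p + f x) → 0 ≤ L p + Λ f := by
  let s : PointedCone ℝ (MvPolynomial (Fin d) ℝ × CompactlySupportedContinuousMap (Fin d → ℝ) ℝ) :=
    { carrier := {z | ∀ x ∈ K, 0 ≤ MvPolynomial.eval x z.1 + z.2 x}
      zero_mem' := by intro x _; simp
      add_mem' := by
        intro a b ha hb x hx
        have h1 := ha x hx
        have h2 := hb x hx
        simp only [Prod.fst_add, Prod.snd_add, map_add, CompactlySupportedContinuousMap.add_apply]
        linarith
      smul_mem' := by
        intro c a ha x hx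
        have h1 := mul_nonneg c.2 (ha x hx)
        have : MvPolynomial.eval x (c • a).1 + (c • a).2 x
            = c * (MvPolynomial.eval x a.1 + a.2 x) := by
          have e1 : (c • a).1 = (c : ℝ) • a.1 := rfl
          have e2 : (c • a).2 x = (c : ℝ) * a.2 x := rfl
          rw [e1, e2, MvPolynomial.smul_eval]; ring
        rw [this]; exact h1 }
  let f : (MvPolynomial (Fin d) ℝ × CompactlySupportedContinuousMap (Fin d → ℝ) ℝ) →ₗ.[ℝ] ℝ :=
    { domain := Submodule.prod ⊤ ⊥
      toFun := (L ∘ₗ LinearMap.fst ℝ _ _) ∘ₗ Submodule.subtype _ }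
  obtain ⟨g, hg1, hg2⟩ := riesz_extension s f (by
      rintro ⟨⟨p, q⟩, hp, hq⟩ hs
      have hq0 : q = 0 := by simpa using hq
      subst hq0
      refine hL p fun x hx => ?_
      simpa using hs x hx) (by
      rintro ⟨q, h⟩
      obtain ⟨C, hC⟩ := h.hasCompactSupport.exists_bound_of_continuous h.continuous
      refine ⟨⟨(-q + MvPolynomial.C C, 0), by simp, by simp⟩, fun x hx => ?_⟩
      have := (abs_le.1 (hC x)).1
      simp
      linarith)
  refine ⟨g ∘ₗ LinearMap.inr ℝ _ _, fun p h hp => ?_⟩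
  have h1 := hg2 (p, h) hp
  have h2 := hg1 ⟨(p, 0), by simp, by simp⟩
  have h3 : g (p, h) = g (p, 0) + g (0, h) := by rw [← map_add]; simp
  rw [h3] at h1
  have h4 : g (p, 0) = L p := h2
  rw [h4] at h1
  exact h1

lemma hav_bump (d : ℕ) (n : ℕ) : ∃ χ : C(Fin d → ℝ, ℝ), HasCompactSupport χ ∧
    (∀ x, 0 ≤ χ x ∧ χ x ≤ 1) ∧ ∀ x, ‖x‖ ≤ n → χ x = 1 := by
  obtain ⟨f, h1, h2, h3, h4⟩ := exists_continuous_one_zero_of_isCompact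
    (isCompact_closedBall (0 : Fin d → ℝ) n) (isClosed_empty) (by simp)
  refine ⟨f, h3, h4, fun x hx => h1 (by simpa using hx)⟩

theorem hav_main (d : ℕ) (K : Set (Fin d → ℝ)) (hK : IsClosed K)
    (L : MvPolynomial (Fin d) ℝ →ₗ[ℝ] ℝ)
    (hL : ∀ p : MvPolynomial (Fin d) ℝ, (∀ x ∈ K, 0 ≤ MvPolynomial.eval x p) → 0 ≤ L p) :
    (∃ μ : Measure (Fin d → ℝ), IsRadon μ ∧ μ Kᶜ = 0 ∧
      ∀ p : MvPolynomial (Fin d) ℝ,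
        Integrable (fun x => MvPolynomial.eval x p) μ ∧
        L p = ∫ x, MvPolynomial.eval x p ∂μ) := by
  obtain ⟨Λ0, hΛ⟩ := hav_ext d K L hL
  have hpos : ∀ f : CompactlySupportedContinuousMap (Fin d → ℝ) ℝ,
      (∀ x ∈ K, 0 ≤ f x) → 0 ≤ Λ0 f := fun f hf => by
    have := hΛ 0 f (by simpa using hf)
    simpa using this
  let Λ : CompactlySupportedContinuousMap (Fin d → ℝ) ℝ →ₚ[ℝ] ℝ :=
    PositiveLinearMap.mk₀ Λ0 (fun f hf => hpos f (fun x _ => hf x))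
  let μ := RealRMK.rieszMeasure Λ
  have hμ : ∀ f : CompactlySupportedContinuousMap (Fin d → ℝ) ℝ, ∫ x, f x ∂μ = Λ0 f :=
    fun f => RealRMK.integral_rieszMeasure Λ f
  have hcont : ∀ p : MvPolynomial (Fin d) ℝ, Continuous fun x => MvPolynomial.eval x p :=
    fun p => MvPolynomial.continuous_eval p
  choose χ hχc hχ01 hχ1 using hav_bump d
  let F : MvPolynomial (Fin d) ℝ → ℕ → CompactlySupportedContinuousMap (Fin d → ℝ) ℝ :=
    fun p n => ⟨⟨fun x => MvPolynomial.eval x p * χ n x, (hcont p).mul (χ n).continuous⟩,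
      (hχc n).mul_left⟩
  have hF : ∀ p n x, F p n x = MvPolynomial.eval x p * χ n x := fun _ _ _ => rfl
  have hFint : ∀ p n, Integrable (F p n) μ := fun p n =>
    (F p n).continuous.integrable_of_hasCompactSupport (F p n).hasCompactSupport
  -- integrability of nonneg polynomials
  have hint0 : ∀ p : MvPolynomial (Fin d) ℝ, (∀ x, 0 ≤ MvPolynomial.eval x p) →
      Integrable (fun x => MvPolynomial.eval x p) μ := by
    intro p hp
    refine ⟨(hcont p).aestronglyMeasurable, ?_⟩
    rw [hasFiniteIntegral_iff_ofReal (Filter.Eventually.of_forall hp)]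
    have key : ∀ n, ∫⁻ x, ENNReal.ofReal (F p n x) ∂μ ≤ ENNReal.ofReal (L p) := by
      intro n
      rw [← ofReal_integral_eq_lintegral_ofReal (hFint p n)
        (Filter.Eventually.of_forall fun x => mul_nonneg (hp x) (hχ01 n x).1), hμ]
      apply ENNReal.ofReal_le_ofReal
      have := hΛ p (-F p n) (fun x _ => by
        simp only [CompactlySupportedContinuousMap.neg_apply, hF]
        nlinarith [hp x, (hχ01 n x).2])
      rw [map_neg] at this
      linarith
    have hle : ∫⁻ x, ENNReal.ofReal (MvPolynomial.eval x p) ∂μ ≤ ENNReal.ofReal (L p) := by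
      calc ∫⁻ x, ENNReal.ofReal (MvPolynomial.eval x p) ∂μ
          ≤ ∫⁻ x, Filter.liminf (fun n => ENNReal.ofReal (F p n x)) Filter.atTop ∂μ := by
            apply lintegral_mono
            intro x
            have : Filter.Tendsto (fun n => ENNReal.ofReal (F p n x)) Filter.atTop
                (nhds (ENNReal.ofReal (MvPolynomial.eval x p))) := by
              apply tendsto_const_nhds.congr'
              obtain ⟨m, hm⟩ := exists_nat_ge ‖x‖
              filter_upwards [Filter.eventually_ge_atTop m] with n hn
              rw [hF, hχ1 n x (hm.trans (by exact_mod_cast hn)), mul_one]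
            exact this.liminf_eq.ge
        _ ≤ Filter.liminf (fun n => ∫⁻ x, ENNReal.ofReal (F p n x) ∂μ) Filter.atTop :=
            lintegral_liminf_le (fun n => (F p n).continuous.measurable.ennreal_ofReal)
        _ ≤ Filter.liminf (fun n : ℕ => ENNReal.ofReal (L p)) Filter.atTop :=
            Filter.liminf_le_liminf (Filter.Eventually.of_forall key)
        _ = _ := Filter.liminf_const _
    exact hle.trans_lt ENNReal.ofReal_lt_top
  have hint : ∀ p : MvPolynomial (Fin d) ℝ, Integrable (fun x => MvPolynomial.eval x p) μ := by
    intro p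
    refine (hint0 (1 + p ^ 2) (fun x => by simp; positivity)).mono'
      (hcont p).aestronglyMeasurable (Filter.Eventually.of_forall fun x => ?_)
    simp only [map_add, map_one, map_pow, Real.norm_eq_abs]
    rw [abs_le]
    constructor <;> nlinarith [sq_nonneg (MvPolynomial.eval x p + 1), sq_nonneg (MvPolynomial.eval x p - 1)]
  have hfin : IsFiniteMeasure μ := by
    have := hint 1
    simp only [map_one] at this
    exact (integrable_const_iff_isFiniteMeasure one_ne_zero).1 this
  have hreg : μ.Regular := RealRMK.regular_rieszMeasure Λ
  refine ⟨μ, ⟨inferInstance, inferInstance⟩, ?_, fun p => ⟨hint p, ?_⟩⟩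
  · rw [hK.isOpen_compl.measure_eq_iSup_isCompact]
    simp only [ENNReal.iSup_eq_zero]
    intro C hC hCc
    obtain ⟨f, h1, h2, h3, h4⟩ := exists_continuous_one_zero_of_isCompact hCc hK
      (Set.disjoint_left.2 fun x hx => hC hx)
    let f' : CompactlySupportedContinuousMap (Fin d → ℝ) ℝ := ⟨f, h3⟩
    have hle : μ C ≤ ENNReal.ofReal (Λ f') :=
      RealRMK.rieszMeasure_le_of_eq_one Λ (f := f') (fun x => (h4 x).1) hCc (fun x hx => h1 hx)
    have h0 : 0 ≤ Λ0 (-f') := hpos _ (fun x hx => by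
      have : f x = 0 := h2 hx
      have h' : (-f') x = - f x := rfl
      rw [h', this]; simp)
    rw [map_neg] at h0
    have h5 : Λ f' ≤ 0 := by
      have : Λ f' = Λ0 f' := rfl
      linarith
    rw [ENNReal.ofReal_of_nonpos h5] at hle
    exact le_antisymm hle bot_le
  · let N : MvPolynomial (Fin d) ℝ := ∑ i, MvPolynomial.X i ^ 2
    have hN : ∀ x, MvPolynomial.eval x N = ∑ i, x i ^ 2 := fun x => by simp [N]
    have hN0 : ∀ x, 0 ≤ MvPolynomial.eval x N := fun x => by
      rw [hN]; positivity
    have hNn : ∀ (x : Fin d → ℝ) (n : ℕ), (n : ℝ) < ‖x‖ → (n : ℝ) ≤ MvPolynomial.eval x N := by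
      intro x n hn
      by_contra hcon
      push Not at hcon
      refine absurd hn (not_lt.2 ((pi_norm_le_iff_of_nonneg (Nat.cast_nonneg n)).2 fun i => ?_))
      have h1 : x i ^ 2 ≤ MvPolynomial.eval x N := by
        rw [hN]
        exact Finset.single_le_sum (f := fun i => x i ^ 2) (fun i _ => sq_nonneg _) (Finset.mem_univ i)
      have hn1 : (n : ℝ) ≤ (n : ℝ) ^ 2 := by exact_mod_cast Nat.le_self_pow two_ne_zero n
      exact abs_le_of_sq_le_sq (by linarith) (Nat.cast_nonneg n)
    let h : MvPolynomial (Fin d) ℝ := (1 + p ^ 2) * (1 + N)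
    have hh : ∀ x, MvPolynomial.eval x h
        = (1 + MvPolynomial.eval x p ^ 2) * (1 + MvPolynomial.eval x N) := fun x => by simp [h]
    have hbd : ∀ (n : ℕ) x, |MvPolynomial.eval x p - F p n x|
        ≤ (1 / (1 + n : ℝ)) * MvPolynomial.eval x h := by
      intro n x
      rw [hF, hh]
      by_cases hx : ‖x‖ ≤ n
      · rw [hχ1 n x hx, mul_one, sub_self, abs_zero]
        have := hN0 x
        positivity
      · have h1 := hNn x n (not_le.1 hx)
        have h2 : |MvPolynomial.eval x p - MvPolynomial.eval x p * χ n x|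
            ≤ 1 + MvPolynomial.eval x p ^ 2 := by
          have e : MvPolynomial.eval x p - MvPolynomial.eval x p * χ n x
            = MvPolynomial.eval x p * (1 - χ n x) := by ring
          rw [e, abs_mul, abs_of_nonneg (a := 1 - χ n x) (by linarith [(hχ01 n x).2])]
          nlinarith [abs_nonneg (MvPolynomial.eval x p), (hχ01 n x).1,
            sq_abs (MvPolynomial.eval x p), sq_nonneg (|MvPolynomial.eval x p| - 1),
            mul_nonneg (abs_nonneg (MvPolynomial.eval x p)) (hχ01 n x).1]
        refine h2.trans ?_
        rw [one_div, ← div_eq_inv_mul, le_div_iff₀ (by positivity)]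
        gcongr
    have hfinal : ∀ n : ℕ, |L p - ∫ x, MvPolynomial.eval x p ∂μ|
        ≤ (1 / (1 + n : ℝ)) * (L h + ∫ x, MvPolynomial.eval x h ∂μ) := by
      intro n
      set c : ℝ := 1 / (1 + n : ℝ) with hc
      have a1 := hΛ (c • h - p) (F p n) (fun x _ => by
        have := (abs_le.1 (hbd n x)).2
        rw [map_sub, MvPolynomial.smul_eval]; linarith)
      have a2 := hΛ (c • h + p) (-F p n) (fun x _ => by
        have := (abs_le.1 (hbd n x)).1
        rw [map_add, MvPolynomial.smul_eval, CompactlySupportedContinuousMap.neg_apply]; linarith)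
      rw [map_sub, map_smul, smul_eq_mul] at a1
      rw [map_add, map_smul, smul_eq_mul, map_neg] at a2
      have a3 : |∫ x, MvPolynomial.eval x p ∂μ - Λ0 (F p n)|
          ≤ c * ∫ x, MvPolynomial.eval x h ∂μ := by
        rw [← hμ, ← integral_sub (hint p) (hFint p n), ← integral_const_mul]
        refine (abs_integral_le_integral_abs).trans ?_
        exact integral_mono ((hint p).sub (hFint p n)).abs ((hint h).const_mul c) (hbd n)
      rw [abs_le] at a3 ⊢
      constructor <;> linarith [a3.1, a3.2]
    have hlim : Filter.Tendsto (fun n : ℕ => (1 / (1 + n : ℝ)) *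
        (L h + ∫ x, MvPolynomial.eval x h ∂μ)) Filter.atTop (nhds 0) := by
      have := (tendsto_one_div_add_atTop_nhds_zero_nat (𝕜 := ℝ)).mul_const
        (L h + ∫ x, MvPolynomial.eval x h ∂μ)
      simpa [add_comm] using this
    have := ge_of_tendsto' hlim hfinal
    exact sub_eq_zero.1 (abs_nonpos_iff.1 this)

/-- Haviland's theorem. -/
theorem haviland (d : ℕ) (K : Set (Fin d → ℝ)) (hK : IsClosed K)
    (L : MvPolynomial (Fin d) ℝ →ₗ[ℝ] ℝ) :
    (∀ p : MvPolynomial (Fin d) ℝ, (∀ x ∈ K, 0 ≤ MvPolynomial.eval x p) → 0 ≤ L p) ↔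
    (∃ μ : Measure (Fin d → ℝ), IsRadon μ ∧ μ Kᶜ = 0 ∧
      ∀ p : MvPolynomial (Fin d) ℝ,
        Integrable (fun x => MvPolynomial.eval x p) μ ∧
        L p = ∫ x, MvPolynomial.eval x p ∂μ) := by
  refine ⟨hav_main d K hK L, ?_⟩
  rintro ⟨μ, -, hμ, h⟩ p hp
  rw [(h p).2]
  apply integral_nonneg_of_ae
  have : ∀ᵐ x ∂μ, x ∈ K := hμ
  filter_upwards [this] with x hx using hp x hx
end

section
/- Stieltjes' theorem: For a real sequence s = (s_n)_{n∈ℕ₀} the following are equivalent: (i) there exists a Radon measure μ on ℝ supported on [0,+∞) such that for every n the function x^n is μ-integrable and s_n = ∫₀^∞ x^n dμ(x); (ii) for every n ∈ ℕ₀ both Hankel matrices H_n(s) and H_n(Es) are positive semidefinite, where Es is the shifted sequence (Es)_n = s_{n+1}. -/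
open MeasureTheory

open Polynomial Filter Topology Set
open scoped NNReal CompactlySupported

theorem st_dense {q : ℝ[X]} {x0 : ℝ} (h : ∀ x, 0 < x → x ≠ x0 → 0 ≤ q.eval x) :
    ∀ x, 0 ≤ x → 0 ≤ q.eval x := by
  intro y hy
  by_contra! hneg
  have h1 : ∀ᶠ x in 𝓝[>] y, q.eval x < 0 :=
    nhdsWithin_le_nhds (q.continuous.continuousAt.eventually_lt continuousAt_const hneg)
  have h2 : ∀ᶠ x in 𝓝[>] y, x ≠ x0 := by
    rcases eq_or_ne y x0 with rfl | hne
    · filter_upwards [self_mem_nhdsWithin] with x hx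
      exact ne_of_gt hx
    · exact nhdsWithin_le_nhds (isOpen_ne.mem_nhds hne)
  have h3 : ∀ᶠ x in 𝓝[>] y, y < x := self_mem_nhdsWithin
  obtain ⟨x, hx1, hx2, hx3⟩ := (h1.and (h2.and h3)).exists
  exact absurd (h x (hy.trans_lt hx3) hx2) (not_le.2 hx1)

theorem st_min {p : ℝ[X]} (hp : ∀ x, 0 ≤ x → 0 ≤ p.eval x) (hd : 0 < p.degree) :
    ∃ x0, 0 ≤ x0 ∧ ∀ x, 0 ≤ x → p.eval x0 ≤ p.eval x := by
  have hl : 0 ≤ p.leadingCoeff := by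
    by_contra! hneg
    have := p.tendsto_atBot_of_leadingCoeff_nonpos hd hneg.le
    obtain ⟨x, hx1, hx2⟩ := ((this.eventually (eventually_lt_atBot 0)).and
      (eventually_ge_atTop 0)).exists
    exact absurd (hp x hx2) (not_le.2 hx1)
  have ht := p.tendsto_atTop_of_leadingCoeff_nonneg hd hl
  obtain ⟨x, hx, hm⟩ := ContinuousOn.exists_isMinOn' (s := Ici (0:ℝ)) (f := fun x => p.eval x)
    p.continuous.continuousOn isClosed_Ici (x₀ := 0) (by simp) (by
      have h1 := ht.eventually (eventually_ge_atTop (p.eval 0))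
      obtain ⟨a, ha⟩ := eventually_atTop.1 h1
      rw [eventually_inf_principal]
      filter_upwards [(isCompact_Icc (a := (0:ℝ)) (b := a)).compl_mem_cocompact] with x hx hx0
      apply ha
      by_contra! hxa
      exact hx ⟨hx0, hxa.le⟩)
  exact ⟨x, hx, fun y hy => hm hy⟩

theorem st_pos (n : ℕ) : ∀ (L : ℝ[X] →ₗ[ℝ] ℝ), (∀ q, 0 ≤ L (q * q)) → (∀ q, 0 ≤ L (X * (q * q))) →
    ∀ p : ℝ[X], p.natDegree ≤ n → (∀ x, 0 ≤ x → 0 ≤ p.eval x) → 0 ≤ L p := by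
  have hconst : ∀ (L : ℝ[X] →ₗ[ℝ] ℝ), (∀ q, 0 ≤ L (q * q)) → ∀ c : ℝ, 0 ≤ c → 0 ≤ L (C c) := by
    intro L h1 c hc
    have := h1 (C (√c))
    rwa [← C_mul, Real.mul_self_sqrt hc] at this
  induction n using Nat.strong_induction_on with
  | _ n ih =>
  intro L h1 h2 p hpn hp
  by_cases hd : p.natDegree = 0
  · rw [eq_C_of_natDegree_eq_zero hd]
    apply hconst L h1
    have := hp 0 le_rfl
    rw [eq_C_of_natDegree_eq_zero hd] at this
    simpa using this
  have hd' : 0 < p.degree := natDegree_pos_iff_degree_pos.1 (Nat.pos_of_ne_zero hd)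
  obtain ⟨x0, hx0, hmin⟩ := st_min hp hd'
  set m := p.eval x0 with hm
  have hm0 : 0 ≤ m := hp x0 hx0
  set r := p - C m with hr
  have hpr : p = r + C m := by simp [hr]
  have hrd : r.natDegree = p.natDegree := by rw [hr, natDegree_sub_C]
  have hr0 : r ≠ 0 := by
    intro h; rw [h] at hrd; simp at hrd; exact hd hrd.symm
  have hroot : r.IsRoot x0 := by simp [hr, hm]
  have hrnn : ∀ x, 0 ≤ x → 0 ≤ r.eval x := by
    intro x hx; simp [hr, hmin x hx]
  have hLr : 0 ≤ L r := by
    rcases hx0.eq_or_lt with h0 | h0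
    · subst h0
      obtain ⟨q, hq⟩ := dvd_iff_isRoot.2 hroot
      simp only [C_0, sub_zero] at hq
      have hq0 : q ≠ 0 := by rintro rfl; simp at hq; exact hr0 hq
      have hqd : r.natDegree = 1 + q.natDegree := by
        rw [hq, natDegree_mul X_ne_zero hq0, natDegree_X]
      have := ih q.natDegree (by omega) (L ∘ₗ LinearMap.mulLeft ℝ X) (fun f => by simpa using h2 f)
        (fun f => by
          have := h1 (X * f)
          simp only [LinearMap.comp_apply, LinearMap.mulLeft_apply]
          convert this using 2; ring) q le_rfl (st_dense (x0 := 0) (fun x hx _ => by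
            have := hrnn x hx.le
            rw [hq, eval_mul, eval_X] at this
            exact nonneg_of_mul_nonneg_right this hx))
      rw [hq]; simpa using this
    · have hder : (derivative r).IsRoot x0 := by
        have hlm : IsLocalMin (fun x => r.eval x) x0 := by
          filter_upwards [Ioi_mem_nhds h0] with x hx
          rw [hroot.eq_zero]; exact hrnn x (le_of_lt hx)
        have := hlm.deriv_eq_zero
        rwa [Polynomial.deriv] at this
      have hmul := (one_lt_rootMultiplicity_iff_isRoot hr0).2 ⟨hroot, hder⟩
      obtain ⟨q, hq⟩ := (le_rootMultiplicity_iff hr0).1 hmul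
      have hq0 : q ≠ 0 := by rintro rfl; simp at hq; exact hr0 hq
      have hqd : r.natDegree = 2 + q.natDegree := by
        rw [hq, natDegree_mul (pow_ne_zero _ (X_sub_C_ne_zero x0)) hq0, natDegree_pow,
          natDegree_X_sub_C]
      have := ih q.natDegree (by omega) (L ∘ₗ LinearMap.mulLeft ℝ ((X - C x0)^2))
        (fun f => by
          have := h1 ((X - C x0) * f)
          simp only [LinearMap.comp_apply, LinearMap.mulLeft_apply]
          convert this using 2; ring)
        (fun f => by
          have := h2 ((X - C x0) * f)
          simp only [LinearMap.comp_apply, LinearMap.mulLeft_apply]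
          convert this using 2; ring) q le_rfl (st_dense (x0 := x0) (fun x hx hne => by
            have := hrnn x hx.le
            rw [hq] at this
            simp only [eval_mul, eval_pow, eval_sub, eval_X, eval_C] at this
            refine nonneg_of_mul_nonneg_right this ?_
            have := sub_ne_zero.2 hne
            exact (even_two).pow_pos this))
      rw [hq]; simpa using this
  rw [hpr, map_add]
  exact add_nonneg hLr (hconst L h1 m hm0)

/-- functions of at most polynomial growth -/
def StE : Submodule ℝ (ℝ≥0 → ℝ) where
  carrier := {f | ∃ p : ℝ[X], ∀ x : ℝ≥0, |f x| ≤ p.eval (x : ℝ)}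
  add_mem' := by
    rintro f g ⟨p, hp⟩ ⟨q, hq⟩
    exact ⟨p + q, fun x => by
      rw [eval_add]; exact (abs_add_le _ _).trans (add_le_add (hp x) (hq x))⟩
  zero_mem' := ⟨0, by simp⟩
  smul_mem' := by
    rintro c f ⟨p, hp⟩
    exact ⟨C |c| * p, fun x => by
      simp only [Pi.smul_apply, smul_eq_mul, abs_mul, eval_mul, eval_C]
      exact mul_le_mul_of_nonneg_left (hp x) (abs_nonneg _)⟩

/-- evaluation -/
noncomputable def stEv : ℝ[X] →ₗ[ℝ] StE where
  toFun p := ⟨fun x => p.eval (x : ℝ), p * p + 1, fun x => by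
    simp only [eval_add, eval_mul, eval_one]
    rw [abs_le]; constructor <;> nlinarith [sq_nonneg (p.eval (x:ℝ) - 1), sq_nonneg (p.eval (x:ℝ) + 1)]⟩
  map_add' p q := by ext x; simp
  map_smul' c p := by ext x; simp

theorem stEv_inj : Function.Injective stEv := by
  intro p q h
  apply eq_of_infinite_eval_eq
  apply (Ici_infinite (0:ℝ)).mono
  intro x hx
  have := congrFun (congrArg Subtype.val h) ⟨x, hx⟩
  exact this

theorem st_ext (L : ℝ[X] →ₗ[ℝ] ℝ) (hL : ∀ p : ℝ[X], (∀ x, 0 ≤ x → 0 ≤ p.eval x) → 0 ≤ L p) :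
    ∃ g : StE →ₗ[ℝ] ℝ, (∀ p, g (stEv p) = L p) ∧
      ∀ f : StE, (∀ x, 0 ≤ f.1 x) → 0 ≤ g f := by
  let e := LinearEquiv.ofInjective stEv stEv_inj
  let F : StE →ₗ.[ℝ] ℝ := ⟨LinearMap.range stEv, L ∘ₗ e.symm.toLinearMap⟩
  let s : PointedCone ℝ StE :=
    { carrier := {f | ∀ x, 0 ≤ f.1 x}
      add_mem' := fun {a b} ha hb x => add_nonneg (ha x) (hb x)
      zero_mem' := fun x => le_rfl
      smul_mem' := fun c f hf x => mul_nonneg c.2 (hf x) }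
  have hF : ∀ p, F ⟨stEv p, p, rfl⟩ = L p := by
    intro p
    change L (e.symm ⟨stEv p, p, rfl⟩) = L p
    congr 1
    rw [LinearEquiv.symm_apply_eq]
    rfl
  obtain ⟨g, hg1, hg2⟩ := riesz_extension s F (by
    rintro ⟨_, p, rfl⟩ hx
    rw [hF]
    apply hL
    intro x hx0
    exact hx ⟨x, hx0⟩) (by
    rintro ⟨f, p, hp⟩
    refine ⟨⟨stEv p, p, rfl⟩, fun x => ?_⟩
    change 0 ≤ p.eval (x:ℝ) + f x
    linarith [neg_abs_le (f x), hp x])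
  refine ⟨g, fun p => ?_, hg2⟩
  rw [← hF]
  exact hg1 ⟨stEv p, p, rfl⟩

theorem st_cc (f : C_c(ℝ≥0, ℝ)) : (f : ℝ≥0 → ℝ) ∈ StE := by
  obtain ⟨c, hc⟩ := f.hasCompactSupport.exists_bound_of_continuous f.continuous
  exact ⟨C c, fun x => by simpa using hc x⟩

/-- inclusion -/
def stIncl : C_c(ℝ≥0, ℝ) →ₗ[ℝ] StE where
  toFun f := ⟨f, st_cc f⟩
  map_add' f g := rfl
  map_smul' c f := rfl

/-- cutoff times power -/
noncomputable def stCut (n k : ℕ) : C_c(ℝ≥0, ℝ) where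
  toFun x := (x:ℝ)^n * max 0 (min 1 ((k:ℝ) + 1 - x))
  continuous_toFun := by fun_prop
  hasCompactSupport' := by
    apply HasCompactSupport.intro (isCompact_Icc (a := (0:ℝ≥0)) (b := (k:ℝ≥0) + 1))
    intro x hx
    have : (k:ℝ) + 1 < x := by
      by_contra! h
      exact hx ⟨zero_le, by exact_mod_cast h⟩
    rw [max_eq_left, mul_zero]
    exact (min_le_right _ _).trans (by linarith)

theorem stCut_apply (n k : ℕ) (x : ℝ≥0) :
    stCut n k x = (x:ℝ)^n * max 0 (min 1 ((k:ℝ) + 1 - x)) := rfl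

theorem stCut_nonneg (n k : ℕ) (x : ℝ≥0) : 0 ≤ stCut n k x := by
  rw [stCut_apply]; positivity

theorem st_measure (L : ℝ[X] →ₗ[ℝ] ℝ) (hL : ∀ p : ℝ[X], (∀ x, 0 ≤ x → 0 ≤ p.eval x) → 0 ≤ L p) :
    ∃ μ : Measure ℝ≥0, ∀ n, ∫⁻ x : ℝ≥0, ENNReal.ofReal ((x:ℝ)^n) ∂μ = ENNReal.ofReal (L (X^n)) := by
  obtain ⟨g, hg, hpos⟩ := st_ext L hL
  let Λ : C_c(ℝ≥0, ℝ) →ₚ[ℝ] ℝ := PositiveLinearMap.mk₀ (g ∘ₗ stIncl) (fun f hf => by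
    apply hpos
    intro x
    exact hf x)
  have hΛ : ∀ f, Λ f = g (stIncl f) := fun f => rfl
  refine ⟨RealRMK.rieszMeasure Λ, fun n => ?_⟩
  set μ := RealRMK.rieszMeasure Λ with hμ
  have hint : ∀ k, ∫⁻ x, ENNReal.ofReal (stCut n k x) ∂μ = ENNReal.ofReal (Λ (stCut n k)) := by
    intro k
    rw [← RealRMK.integral_rieszMeasure Λ, ofReal_integral_eq_lintegral_ofReal]
    · exact (stCut n k).continuous.integrable_of_hasCompactSupport (stCut n k).hasCompactSupport
    · exact Eventually.of_forall (stCut_nonneg n k)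
  have hmono : ∀ (x : ℝ≥0), Monotone fun k => stCut n k x := by
    intro x k l hkl
    simp only [stCut_apply]
    have : (k:ℝ) ≤ l := by exact_mod_cast hkl
    gcongr
  have hlim : ∀ (x : ℝ≥0), Tendsto (fun k => stCut n k x) atTop (𝓝 ((x:ℝ)^n)) := by
    intro x
    apply tendsto_const_nhds.congr'
    obtain ⟨N, hN⟩ := exists_nat_ge (x:ℝ)
    filter_upwards [eventually_ge_atTop N] with k hk
    have : (N:ℝ) ≤ k := by exact_mod_cast hk
    rw [stCut_apply, min_eq_left (by linarith), max_eq_right zero_le_one, mul_one]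
  have h1 := lintegral_tendsto_of_tendsto_of_monotone (μ := μ)
    (f := fun k x => ENNReal.ofReal (stCut n k x)) (F := fun x : ℝ≥0 => ENNReal.ofReal ((x:ℝ)^n))
    (fun k => ((stCut n k).continuous.measurable.ennreal_ofReal).aemeasurable)
    (Eventually.of_forall fun x k l hkl => ENNReal.ofReal_le_ofReal (hmono x hkl))
    (Eventually.of_forall fun x => (ENNReal.continuous_ofReal.tendsto _).comp (hlim x))
  simp only [hint] at h1
  refine tendsto_nhds_unique h1 ((ENNReal.continuous_ofReal.tendsto _).comp ?_)
  have hup : ∀ k, Λ (stCut n k) ≤ L (X^n) := by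
    intro k
    rw [hΛ, ← hg, ← sub_nonneg, ← map_sub]
    apply hpos
    intro x
    change 0 ≤ (X^n : ℝ[X]).eval (x:ℝ) - stCut n k x
    rw [stCut_apply, eval_pow, eval_X, sub_nonneg]
    exact mul_le_of_le_one_right (by positivity) (max_le zero_le_one (min_le_left _ _))
  have hlo : ∀ k : ℕ, L (X^n) - L (X^(n+1)) * (1 / ((k:ℝ)+1)) ≤ Λ (stCut (n) (k+1)) := by
    intro k
    have : 0 ≤ g (stIncl (stCut n (k+1)) - (stEv (X^n) - (1 / ((k:ℝ)+1)) • stEv (X^(n+1)))) := by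
      apply hpos
      intro x
      change 0 ≤ stCut n (k+1) x - ((X^n : ℝ[X]).eval (x:ℝ) -
        (1 / ((k:ℝ)+1)) * (X^(n+1) : ℝ[X]).eval (x:ℝ))
      rw [stCut_apply, eval_pow, eval_X, eval_pow, eval_X]
      have hx : (0:ℝ) ≤ x := x.2
      have hk : (0:ℝ) < (k:ℝ) + 1 := by positivity
      have key : 0 ≤ max 0 (min 1 (((k+1:ℕ):ℝ) + 1 - x)) - (1 - (1 / ((k:ℝ)+1)) * x) := by
        rcases le_total (x:ℝ) (k+1) with h | h
        · rw [min_eq_left (by push_cast; linarith), max_eq_right zero_le_one]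
          have : 0 ≤ (1 / ((k:ℝ)+1)) * x := by positivity
          linarith
        · have h1 : 1 ≤ (1 / ((k:ℝ)+1)) * x := by
            rw [one_div, ← div_eq_inv_mul, le_div_iff₀ hk]; linarith
          have := le_max_left 0 (min 1 (((k+1:ℕ):ℝ) + 1 - x))
          linarith
      have := mul_nonneg (pow_nonneg hx n) key
      refine this.trans_eq ?_
      ring
    rw [map_sub, map_sub, map_smul, hg, hg, ← hΛ, smul_eq_mul] at this
    linarith
  rw [← tendsto_add_atTop_iff_nat 1]
  refine tendsto_of_tendsto_of_tendsto_of_le_of_le ?_ tendsto_const_nhds hlo (fun k => hup _)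
  have := (tendsto_one_div_add_atTop_nhds_zero_nat (𝕜 := ℝ)).const_mul (L (X^(n+1)))
  simpa using this.const_sub (L (X^n))

/-- the moment functional -/
noncomputable def stL (s : ℕ → ℝ) : ℝ[X] →ₗ[ℝ] ℝ := Polynomial.lsum fun n => s n • LinearMap.id

theorem stL_monomial (s : ℕ → ℝ) (n : ℕ) (c : ℝ) : stL s (monomial n c) = c * s n := by
  simp [stL, Polynomial.lsum_apply, sum_monomial_index, mul_comm]

theorem st_quad (s : ℕ → ℝ) (d n : ℕ) (v : Fin (n+1) → ℝ) :
    star v ⬝ᵥ (Matrix.of fun i j : Fin (n + 1) => s ((i : ℕ) + (j : ℕ) + d)).mulVec v =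
      ∑ i, ∑ j, v i * v j * s (i + j + d) := by
  simp only [dotProduct, Matrix.mulVec, Matrix.of_apply, Finset.mul_sum, star_trivial]
  refine Finset.sum_congr rfl fun i _ => Finset.sum_congr rfl fun j _ => by ring

theorem stL_sq (s : ℕ → ℝ) (d : ℕ) (h : ∀ n, Matrix.PosSemidef
    (Matrix.of fun i j : Fin (n + 1) => s ((i : ℕ) + (j : ℕ) + d))) (q : ℝ[X]) :
    0 ≤ stL s (X^d * (q * q)) := by
  have := (h q.natDegree).dotProduct_mulVec_nonneg (fun i => q.coeff i)
  rw [st_quad] at this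
  refine this.trans_eq ?_
  symm
  have hq : q = ∑ i : Fin (q.natDegree + 1), monomial (i:ℕ) (q.coeff i) := by
    rw [Fin.sum_univ_eq_sum_range (fun i => monomial i (q.coeff i))]
    exact q.as_sum_range
  conv_lhs => rw [hq]
  rw [Finset.sum_mul_sum, Finset.mul_sum, map_sum]
  refine Finset.sum_congr rfl fun i _ => ?_
  rw [Finset.mul_sum, map_sum]
  refine Finset.sum_congr rfl fun j _ => ?_
  rw [monomial_mul_monomial, X_pow_mul_monomial, stL_monomial]

theorem st_forward (s : ℕ → ℝ) (μ : Measure ℝ) (h0 : μ (Set.Iio (0 : ℝ)) = 0)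
    (hμ : ∀ n : ℕ, Integrable (fun x : ℝ => x ^ n) μ ∧ s n = ∫ x : ℝ, x ^ n ∂μ) (d n : ℕ) :
    Matrix.PosSemidef (Matrix.of fun i j : Fin (n + 1) => s ((i : ℕ) + (j : ℕ) + d)) := by
  refine Matrix.PosSemidef.of_dotProduct_mulVec_nonneg ?_ fun v => ?_
  · ext i j
    simp [Matrix.conjTranspose_apply, add_comm (j:ℕ)]
  rw [st_quad]
  have : ∑ i, ∑ j, v i * v j * s (i + j + d) =
      ∫ x : ℝ, x^d * (∑ i, v i * x^(i:ℕ))^2 ∂μ := by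
    have e : ∀ x : ℝ, x^d * (∑ i, v i * x^(i:ℕ))^2 =
        ∑ i, ∑ j, v i * v j * x^((i:ℕ) + j + d) := by
      intro x
      rw [pow_two, Finset.sum_mul_sum, Finset.mul_sum]
      refine Finset.sum_congr rfl fun i _ => ?_
      rw [Finset.mul_sum]
      refine Finset.sum_congr rfl fun j _ => by ring
    simp only [e]
    rw [integral_finsetSum _ fun i _ => integrable_finsetSum _ fun j _ => (hμ _).1.const_mul _]
    refine Finset.sum_congr rfl fun i _ => ?_
    rw [integral_finsetSum _ fun j _ => (hμ _).1.const_mul _]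
    refine Finset.sum_congr rfl fun j _ => ?_
    rw [integral_const_mul, (hμ _).2]
  rw [this]
  apply integral_nonneg_of_ae
  have : ∀ᵐ x ∂μ, 0 ≤ x := by
    rw [ae_iff]; simpa [Set.Iio] using h0
  filter_upwards [this] with x hx
  exact mul_nonneg (pow_nonneg hx _) (sq_nonneg _)

theorem st_backward (s : ℕ → ℝ) (h : ∀ d ≤ 1, ∀ n, Matrix.PosSemidef
    (Matrix.of fun i j : Fin (n + 1) => s ((i : ℕ) + (j : ℕ) + d))) :
    ∃ μ : Measure ℝ, IsRadon μ ∧ μ (Set.Iio (0 : ℝ)) = 0 ∧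
      ∀ n : ℕ, Integrable (fun x : ℝ => x ^ n) μ ∧ s n = ∫ x : ℝ, x ^ n ∂μ := by
  have hL : ∀ p : ℝ[X], (∀ x, 0 ≤ x → 0 ≤ p.eval x) → 0 ≤ stL s p := fun p hp =>
    st_pos p.natDegree (stL s) (fun q => by simpa using stL_sq s 0 (h 0 (by simp)) q)
      (fun q => by simpa using stL_sq s 1 (h 1 le_rfl) q) p le_rfl hp
  obtain ⟨ν, hν⟩ := st_measure (stL s) hL
  have hs : ∀ n, stL s (X^n) = s n := fun n => by
    rw [← monomial_one_right_eq_X_pow, stL_monomial, one_mul]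
  have hs0 : ∀ n, 0 ≤ s n := fun n => by
    rw [← hs]; exact hL _ fun x hx => by simpa using pow_nonneg hx n
  simp only [hs] at hν
  have hfin : IsFiniteMeasure ν := ⟨by
    have := hν 0
    simp at this
    rw [this]; exact ENNReal.ofReal_lt_top⟩
  have hm : Measurable ((↑) : ℝ≥0 → ℝ) := NNReal.continuous_coe.measurable
  have hi : ∀ n, Integrable (fun x : ℝ≥0 => (x:ℝ)^n) ν := fun n => by
    refine ⟨(by fun_prop : Continuous fun x : ℝ≥0 => (x:ℝ)^n).aestronglyMeasurable, ?_⟩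
    rw [hasFiniteIntegral_iff_ofReal (Eventually.of_forall fun x => by positivity), hν]
    exact ENNReal.ofReal_lt_top
  refine ⟨ν.map (↑), ⟨inferInstance, inferInstance⟩, ?_, fun n => ⟨?_, ?_⟩⟩
  · rw [Measure.map_apply hm measurableSet_Iio]
    convert measure_empty (μ := ν)
    ext x; simp
  · rw [integrable_map_measure (by fun_prop) hm.aemeasurable]
    exact hi n
  · rw [integral_map hm.aemeasurable (by fun_prop),
      integral_eq_lintegral_of_nonneg_ae (Eventually.of_forall fun x => by positivity)
        (hi n).aestronglyMeasurable, hν, ENNReal.toReal_ofReal (hs0 n)]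

/-- Stieltjes' theorem: a real sequence is a moment sequence of a Radon measure on `[0,∞)`
iff the Hankel matrices of `s` and of the shifted sequence `Es` are positive semidefinite. -/
theorem stieltjes (s : ℕ → ℝ) :
    (∃ μ : Measure ℝ, IsRadon μ ∧ μ (Set.Iio (0 : ℝ)) = 0 ∧
      ∀ n : ℕ, Integrable (fun x : ℝ => x ^ n) μ ∧ s n = ∫ x : ℝ, x ^ n ∂μ) ↔
    (∀ n : ℕ,
      Matrix.PosSemidef (Matrix.of fun i j : Fin (n + 1) => s ((i : ℕ) + (j : ℕ))) ∧
      Matrix.PosSemidef (Matrix.of fun i j : Fin (n + 1) => s ((i : ℕ) + (j : ℕ) + 1))) := by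
  constructor
  · rintro ⟨μ, -, h0, hμ⟩ n
    exact ⟨by simpa using st_forward s μ h0 hμ 0 n, st_forward s μ h0 hμ 1 n⟩
  · intro h
    apply st_backward
    intro d hd n
    interval_cases d
    · simpa using (h n).1
    · exact (h n).2
end

section
/- Hausdorff's theorem: A real sequence s = (s_n)_{n∈ℕ₀} is a [0,1]-moment sequence, i.e. there exists a Radon measure μ on ℝ supported on [0,1] with s_n = ∫₀¹ x^n dμ(x) for all n ∈ ℕ₀, if and only if ∑_{j=0}^n (−1)^j (n choose j) s_{k+j} ≥ 0 for all k, n ∈ ℕ₀. -/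
section HM
open MeasureTheory Polynomial Filter Topology

theorem HM_sum (n m : ℕ) : ∑ k ∈ Finset.range (n+1), (k.choose m : ℝ) • bernsteinPolynomial ℝ n k
    = (n.choose m : ℝ) • (X : ℝ[X])^m := by
  rcases lt_or_ge n m with h | h
  · rw [Nat.choose_eq_zero_of_lt h, Finset.sum_eq_zero]; · simp
    intro k hk
    rw [Nat.choose_eq_zero_of_lt (by simp at hk; omega)]; simp
  obtain ⟨r, rfl⟩ := Nat.exists_eq_add_of_le h
  rw [add_assoc, Finset.sum_range_add, Finset.sum_eq_zero, zero_add]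
  · have h2 := bernsteinPolynomial.sum ℝ r
    conv_rhs => rw [← mul_one (X^m), ← h2, Finset.mul_sum, Finset.smul_sum]
    refine Finset.sum_congr rfl fun k hk => ?_
    have hk : k ≤ r := by simp at hk; omega
    have := Nat.choose_mul (n := m + r) (k := m+k) (s := m) (by omega)
    simp only [bernsteinPolynomial, smul_eq_C_mul]
    have e1 : m + r - (m + k) = r - k := by omega
    have e2 : m + r - m = r := by omega
    have e3 : m + k - m = k := by omega
    rw [e2, e3] at this
    have this' : ((m+r).choose (m+k) : ℝ[X]) * ((m+k).choose m) = (m+r).choose m * r.choose k := by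
      exact_mod_cast this
    rw [e1, pow_add]
    simp only [C_eq_natCast, map_natCast]
    linear_combination (X^m * X^k * (1-X)^(r-k)) * this'
  · intro k hk
    rw [Nat.choose_eq_zero_of_lt (by simpa using hk)]; simp

theorem HM_bound (m : ℕ) : ∃ e : ℕ → ℝ, Tendsto e atTop (𝓝 0) ∧ ∀ n > m, ∀ k ≤ n,
    |((k:ℝ)/n)^m - (k.choose m : ℝ)/(n.choose m)| ≤ e n := by
  induction m with
  | zero => exact ⟨fun _ => 0, tendsto_const_nhds, by simp⟩
  | succ m ih =>
    obtain ⟨e, he, hb⟩ := ih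
    refine ⟨fun n => e n + m / ((n:ℝ) - m), ?_, ?_⟩
    · have : Tendsto (fun n : ℕ => (m:ℝ) / ((n:ℝ) - m)) atTop (𝓝 0) :=
        Tendsto.div_atTop tendsto_const_nhds
          (tendsto_atTop_add_const_right _ (-(m:ℝ)) tendsto_natCast_atTop_atTop)
      simpa using he.add this
    · intro n hn k hk
      have hb := hb n (by omega) k hk
      have hn' : (m:ℝ) + 1 < n := by exact_mod_cast hn
      have hm0 : (0:ℝ) ≤ m := by positivity
      have hk' : (k:ℝ) ≤ n := by exact_mod_cast hk
      have hk0 : (0:ℝ) ≤ k := by positivity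
      have hnm : (0:ℝ) < n - m := by linarith
      have hn0 : (0:ℝ) < n := by linarith
      have hc : ∀ a : ℕ, (a.choose (m+1) : ℝ) * (m+1) = a.choose m * (a - m) := by
        intro a
        rcases lt_or_ge a m with h | h
        · rw [Nat.choose_eq_zero_of_lt h, Nat.choose_eq_zero_of_lt (by omega)]; simp
        · rw [← Nat.cast_sub h]; exact_mod_cast Nat.choose_succ_right_eq a m
      have hp : (0:ℝ) < n.choose m := by exact_mod_cast Nat.choose_pos (by omega)
      have hp1 : (0:ℝ) < n.choose (m+1) := by exact_mod_cast Nat.choose_pos (by omega)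
      have hle : (k.choose m : ℝ) ≤ n.choose m := by exact_mod_cast Nat.choose_le_choose m hk
      set q : ℝ := (k.choose m : ℝ)/(n.choose m) with hq
      have hq0 : 0 ≤ q := by positivity
      have hq1 : q ≤ 1 := by rw [hq, div_le_one hp]; exact hle
      have hs : (k.choose (m+1) : ℝ)/(n.choose (m+1)) = q * ((k - m)/(n-m)) := by
        rw [hq, div_mul_div_comm, ← hc, ← hc, mul_div_mul_right _ _ (by positivity)]
      rw [hs]
      have hd : (k:ℝ)/n - (k-m)/(n-m) = m * (n-k)/(n*(n-m)) := by field_simp; ring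
      have hd0 : 0 ≤ (k:ℝ)/n - (k-m)/(n-m) := by
        rw [hd]; have := sub_nonneg.2 hk'; positivity
      have hd1 : (k:ℝ)/n - (k-m)/(n-m) ≤ m / (n-m) := by
        rw [hd, div_le_div_iff₀ (by positivity) hnm]
        have : 0 ≤ m * (n - m) * (k:ℝ) := by positivity
        nlinarith
      have hx0 : 0 ≤ (k:ℝ)/n := by positivity
      have hx1 : (k:ℝ)/n ≤ 1 := (div_le_one hn0).2 hk'
      calc _ = |(((k:ℝ)/n)^m - q) * (k/n) + q * ((k:ℝ)/n - (k-m)/(n-m))| := by congr 1; ring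
        _ ≤ |((k:ℝ)/n)^m - q| * (k/n) + q * ((k:ℝ)/n - (k-m)/(n-m)) := by
          refine (abs_add_le _ _).trans ?_
          rw [abs_mul, abs_mul, abs_of_nonneg hx0, abs_of_nonneg hq0, abs_of_nonneg hd0]
        _ ≤ e n + m / (n-m) := by
          gcongr
          · exact (mul_le_of_le_one_right (abs_nonneg _) hx1).trans hb
          · exact (mul_le_of_le_one_left hd0 hq1).trans hd1

theorem HM_L (s : ℕ → ℝ) : ∃ L : ℝ[X] →ₗ[ℝ] ℝ, (∀ n, L (X^n) = s n) := by
  refine ⟨(Polynomial.basisMonomials ℝ).constr ℝ s, fun n => ?_⟩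
  rw [X_pow_eq_monomial, show (monomial n (1:ℝ)) = Polynomial.basisMonomials ℝ n by simp, Module.Basis.constr_basis]

theorem HM_expand (k n : ℕ) (R : Type*) [CommRing R] (x : R) : x^k * (1-x)^n =
    ∑ j ∈ Finset.range (n+1), (-1)^j * (n.choose j : R) * x^(k+j) := by
  rw [show 1 - x = -x + 1 by ring, add_pow, Finset.mul_sum]
  refine Finset.sum_congr rfl fun j _ => ?_
  rw [neg_pow, pow_add]; simp; ring

theorem HM_weights (s : ℕ → ℝ) (h : ∀ k n : ℕ, 0 ≤ ∑ j ∈ Finset.range (n + 1), (-1 : ℝ) ^ j * (n.choose j) * s (k + j)) :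
    ∃ a : ℕ → ℕ → ℝ, (∀ n k, 0 ≤ a n k) ∧ (∀ n, ∑ k ∈ Finset.range (n+1), a n k = s 0) ∧
      ∀ m, Tendsto (fun n => ∑ k ∈ Finset.range (n+1), a n k * ((k:ℝ)/n)^m) atTop (𝓝 (s m)) := by
  obtain ⟨L, hL⟩ := HM_L s
  have hpos : ∀ n k, 0 ≤ L (bernsteinPolynomial ℝ n k) := by
    intro n k
    have : bernsteinPolynomial ℝ n k = (n.choose k : ℝ) • ∑ j ∈ Finset.range ((n-k)+1), 
        ((-1:ℝ)^j * ((n-k).choose j)) • (X:ℝ[X])^(k+j) := by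
      rw [bernsteinPolynomial, mul_assoc, HM_expand, smul_eq_C_mul]
      simp [smul_eq_C_mul]
    rw [this]
    simp only [map_smul, map_sum, hL, smul_eq_mul]
    exact mul_nonneg (by positivity) (h _ _)
  have hsum : ∀ n m, ∑ k ∈ Finset.range (n+1), L (bernsteinPolynomial ℝ n k) * (k.choose m) = n.choose m * s m := by
    intro n m
    have := congrArg L (HM_sum n m)
    simp only [map_smul, map_sum, hL, smul_eq_mul] at this
    rw [← this]
    exact Finset.sum_congr rfl fun _ _ => mul_comm _ _
  have h0 : ∀ n, ∑ k ∈ Finset.range (n+1), L (bernsteinPolynomial ℝ n k) = s 0 := by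
    intro n; simpa using hsum n 0
  refine ⟨fun n k => L (bernsteinPolynomial ℝ n k), hpos, h0, fun m => ?_⟩
  obtain ⟨e, he, hb⟩ := HM_bound m
  rw [tendsto_iff_dist_tendsto_zero]
  refine squeeze_zero' (.of_forall fun _ => dist_nonneg) (g := fun n => s 0 * e n) ?_ (by simpa using he.const_mul (s 0))
  filter_upwards [eventually_gt_atTop m] with n hn
  have hp : (0:ℝ) < n.choose m := by exact_mod_cast Nat.choose_pos (by omega)
  have : s m = ∑ k ∈ Finset.range (n+1), L (bernsteinPolynomial ℝ n k) * ((k.choose m : ℝ)/(n.choose m)) := by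
    simp_rw [← mul_div_assoc]
    rw [← Finset.sum_div, hsum]; field_simp
  rw [this, Real.dist_eq, ← Finset.sum_sub_distrib, ← h0 n, Finset.sum_mul]
  refine (Finset.abs_sum_le_sum_abs _ _).trans (Finset.sum_le_sum fun k hk => ?_)
  rw [← mul_sub, abs_mul, abs_of_nonneg (hpos _ _)]
  exact mul_le_mul_of_nonneg_left (hb n hn k (by simp at hk; omega)) (hpos _ _)

theorem HM_functional (s : ℕ → ℝ) (h : ∀ k n : ℕ, 0 ≤ ∑ j ∈ Finset.range (n + 1), (-1 : ℝ) ^ j * (n.choose j) * s (k + j)) :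
    ∃ Λ : C(unitInterval, ℝ) →ₗ[ℝ] ℝ, (∀ f, 0 ≤ f → 0 ≤ Λ f) ∧
      ∀ m (f : C(unitInterval, ℝ)), (∀ x, f x = (x:ℝ)^m) → Λ f = s m := by
  obtain ⟨a, ha, ha0, hm⟩ := HM_weights s h
  have hpt : ∀ n k : ℕ, (min 1 ((k:ℝ)/n)) ∈ unitInterval := fun n k =>
    ⟨le_min zero_le_one (by positivity), min_le_left _ _⟩
  let p : ℕ → ℕ → unitInterval := fun n k => ⟨_, hpt n k⟩
  let T : ℕ → C(unitInterval, ℝ) → ℝ := fun n f => ∑ k ∈ Finset.range (n+1), a n k * f (p n k)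
  let U : Ultrafilter ℕ := hyperfilter ℕ
  have hU : (U : Filter ℕ) ≤ atTop := Nat.hyperfilter_le_atTop
  have hex : ∀ f, ∃ l, Tendsto (fun n => T n f) U (𝓝 l) := by
    intro f
    have hb : ∀ n, T n f ∈ Set.Icc (-(s 0 * ‖f‖)) (s 0 * ‖f‖) := by
      intro n
      rw [Set.mem_Icc, ← abs_le, ← ha0 n, Finset.sum_mul]
      refine (Finset.abs_sum_le_sum_abs _ _).trans (Finset.sum_le_sum fun k hk => ?_)
      rw [abs_mul, abs_of_nonneg (ha _ _)]
      exact mul_le_mul_of_nonneg_left (f.norm_coe_le_norm _) (ha _ _)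
    obtain ⟨l, -, hl⟩ := (isCompact_Icc (a := -(s 0 * ‖f‖)) (b := s 0 * ‖f‖)).ultrafilter_le_nhds
      (U.map (fun n => T n f)) (by
        rw [Filter.le_principal_iff]; exact Filter.mem_map.2 (Filter.univ_mem' hb))
    exact ⟨l, hl⟩
  choose Λ hΛ using hex
  refine ⟨⟨⟨Λ, fun f g => ?_⟩, fun c f => ?_⟩, fun f hf => ?_, fun m f hf => ?_⟩
  · refine tendsto_nhds_unique (hΛ (f+g)) (((hΛ f).add (hΛ g)).congr fun n => ?_)
    simp [T, mul_add, Finset.sum_add_distrib]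
  · refine tendsto_nhds_unique (hΛ (c • f)) (((hΛ f).const_mul c).congr fun n => ?_)
    simp [T, Finset.mul_sum]
    exact Finset.sum_congr rfl fun _ _ => by ring
  · exact ge_of_tendsto' (hΛ f) fun n => Finset.sum_nonneg fun k _ => mul_nonneg (ha _ _) (hf _)
  · refine tendsto_nhds_unique (hΛ f) (((hm m).mono_left hU).congr fun n => ?_)
    refine Finset.sum_congr rfl fun k hk => ?_
    have hk : (k:ℝ) ≤ n := by simp at hk; exact_mod_cast (by omega : k ≤ n)
    rw [hf]
    simp only [p]
    rw [min_eq_right (div_le_one_of_le₀ hk (by positivity))]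

theorem HM_exists (s : ℕ → ℝ) (h : ∀ k n : ℕ, 0 ≤ ∑ j ∈ Finset.range (n + 1), (-1 : ℝ) ^ j * (n.choose j) * s (k + j)) :
    ∃ μ : Measure unitInterval, IsFiniteMeasure μ ∧ ∀ m : ℕ, ∫ x : unitInterval, (x:ℝ)^m ∂μ = s m := by
  obtain ⟨Λ, hpos, hm⟩ := HM_functional s h
  let Φ : CompactlySupportedContinuousMap unitInterval ℝ →ₗ[ℝ] ℝ :=
    { toFun := fun f => Λ f.toContinuousMap
      map_add' := fun f g => by rw [← map_add]; rfl
      map_smul' := fun c f => by rw [RingHom.id_apply, ← map_smul]; rfl }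
  let Ψ := PositiveLinearMap.mk₀ Φ (fun f hf => hpos _ (by intro x; exact CompactlySupportedContinuousMap.le_def.1 hf x))
  have hreg : (RealRMK.rieszMeasure Ψ).Regular := by infer_instance
  refine ⟨RealRMK.rieszMeasure Ψ, inferInstance, fun m => ?_⟩
  let f : C(unitInterval, ℝ) := ⟨fun x => (x:ℝ)^m, by fun_prop⟩
  let g := CompactlySupportedContinuousMap.continuousMapEquiv f
  have := RealRMK.integral_rieszMeasure Ψ g
  exact this.trans (hm m f fun x => rfl)

end HM



open MeasureTheory

/-- Hausdorff's theorem: `s` is a `[0,1]`-moment sequence iff it is completely monotone. -/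
theorem hausdorff_moment (s : ℕ → ℝ) :
    (∃ μ : Measure ℝ, IsRadon μ ∧ μ (Set.Icc (0 : ℝ) 1)ᶜ = 0 ∧
      ∀ n : ℕ, Integrable (fun x : ℝ => x ^ n) μ ∧ s n = ∫ x : ℝ, x ^ n ∂μ) ↔
    (∀ k n : ℕ, 0 ≤ ∑ j ∈ Finset.range (n + 1), (-1 : ℝ) ^ j * (n.choose j) * s (k + j)) := by
  constructor
  · rintro ⟨μ, -, h0, hs⟩ k n
    have e : ∑ j ∈ Finset.range (n + 1), (-1 : ℝ) ^ j * (n.choose j) * s (k + j)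
        = ∫ x : ℝ, x ^ k * (1 - x) ^ n ∂μ := by
      simp_rw [HM_expand]
      rw [integral_finset_sum _ fun j _ => ((hs (k + j)).1.const_mul _)]
      refine Finset.sum_congr rfl fun j _ => ?_
      rw [integral_const_mul, (hs (k + j)).2]
    rw [e]
    refine integral_nonneg_of_ae ?_
    have : ∀ᵐ x ∂μ, x ∈ Set.Icc (0 : ℝ) 1 := h0
    filter_upwards [this] with x hx
    exact mul_nonneg (pow_nonneg hx.1 _) (pow_nonneg (sub_nonneg.2 hx.2) _)
  · intro h
    obtain ⟨μ, hμ, hm⟩ := HM_exists s h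
    have hme : MeasurableEmbedding (Subtype.val : unitInterval → ℝ) :=
      MeasurableEmbedding.subtype_coe measurableSet_Icc
    refine ⟨μ.map Subtype.val, ⟨inferInstance, inferInstance⟩, ?_, fun n => ⟨?_, ?_⟩⟩
    · rw [hme.map_apply]
      convert measure_empty (μ := μ)
      ext x
      simpa using x.2
    · rw [hme.integrable_map_iff]
      refine Continuous.integrable_of_hasCompactSupport ?_ (HasCompactSupport.of_compactSpace _)
      simp only [Function.comp_def]
      fun_prop
    · rw [hme.integral_map, hm]
end

section
/- Carleman's theorem: Let s = (s_n)_{n∈ℕ₀} be a Hamburger moment sequence satisfying the Carleman condition ∑_{n=1}^∞ s_{2n}^{−1/(2n)} = +∞ (with the convention 0^{−1/(2n)} = 0). Then s is determinate: any two Radon measures μ, ν on ℝ such that every x^n is integrable and ∫ x^n dμ = ∫ x^n dν = s_n for all n ∈ ℕ₀ are equal. -/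
open MeasureTheory

/-- `μ` has moment sequence `s`. -/
def HasMoments (μ : Measure ℝ) (s : ℕ → ℝ) : Prop :=
  ∀ n : ℕ, Integrable (fun x : ℝ => x ^ n) μ ∧ s n = ∫ x : ℝ, x ^ n ∂μ

theorem carl_step (M : ℕ → ℝ) (hM : ∀ n, 0 < M n)
    (hmono : Monotone fun n => M (n + 1) / M n)
    (F : ℕ → ℝ → ℂ) (hF : ∀ n t, HasDerivAt (F n) (F (n + 1) t) t)
    (hb : ∀ n t, ‖F n t‖ ≤ M n) (N : ℕ) (x h : ℝ) (h0 : 0 ≤ h)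
    (hh : Real.exp 1 * h ≤ M N / M (N + 1))
    (hP : ∀ j, ‖F j x‖ ≤ Real.exp ((j : ℝ) - (N + 1 : ℕ)) * M j) :
    ∀ j, ‖F j (x + h)‖ ≤ Real.exp ((j : ℝ) - N) * M j := by
  set L := Real.exp 1 * (M (N + 1) / M N) with hL
  have hLpos : 0 < L := by have := hM N; have := hM (N + 1); positivity
  have key : ∀ i j, i + j = N + 1 → ∀ t ∈ Set.Icc x (x + h),
      ‖F j t‖ ≤ Real.exp ((j : ℝ) - (N + 1 : ℕ)) * M j * Real.exp (L * (t - x)) := by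
    intro i
    induction i with
    | zero =>
      intro j hj t ht
      have hj' : j = N + 1 := by omega
      subst hj'
      rw [sub_self, Real.exp_zero, one_mul]
      refine (hb _ t).trans ?_
      have : 1 ≤ Real.exp (L * (t - x)) :=
        Real.one_le_exp (mul_nonneg hLpos.le (by linarith [ht.1]))
      nlinarith [hM (N + 1)]
    | succ i ih =>
      intro j hj
      have ih' := ih (j + 1) (by omega)
      refine image_norm_le_of_norm_deriv_right_le_deriv_boundary
        (f := F j) (f' := F (j + 1))
        (B' := fun t => Real.exp ((j : ℝ) - (N + 1 : ℕ)) * M j * (Real.exp (L * (t - x)) * L))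
        (fun t _ => (hF j t).continuousAt.continuousWithinAt)
        (fun t _ => (hF j t).hasDerivWithinAt) ?_ ?_ ?_
      · simpa using hP j
      · intro t
        have h1 : HasDerivAt (fun t => L * (t - x)) L t := by
          simpa using ((hasDerivAt_id t).sub_const x).const_mul L
        exact (h1.exp).const_mul _
      · intro t ht
        refine (ih' t ⟨ht.1, ht.2.le⟩).trans ?_
        have hm : M (j + 1) / M j ≤ M (N + 1) / M N := hmono (by omega : j ≤ N)
        have hm' : M (j + 1) ≤ M (N + 1) / M N * M j := (div_le_iff₀ (hM j)).1 hm
        have e1 : Real.exp (((j + 1 : ℕ) : ℝ) - (N + 1 : ℕ))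
            = Real.exp ((j : ℝ) - (N + 1 : ℕ)) * Real.exp 1 := by
          rw [← Real.exp_add]; push_cast; ring_nf
        rw [e1, hL]
        calc _ ≤ Real.exp ((j : ℝ) - (N + 1 : ℕ)) * Real.exp 1 * (M (N + 1) / M N * M j)
              * Real.exp (Real.exp 1 * (M (N + 1) / M N) * (t - x)) := by gcongr
          _ = _ := by ring
  intro j
  by_cases hj : j ≤ N
  · refine (key (N + 1 - j) j (by omega) (x + h) ⟨by linarith, le_rfl⟩).trans ?_
    have h1 : L * (x + h - x) ≤ 1 := by
      have := mul_le_mul_of_nonneg_right hh (div_pos (hM (N + 1)) (hM N)).le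
      rw [div_mul_div_cancel₀ (hM (N+1)).ne', div_self (hM N).ne'] at this
      rw [hL]; linarith
    have h2 : Real.exp ((j : ℝ) - N) = Real.exp ((j : ℝ) - (N + 1 : ℕ)) * Real.exp 1 := by
      rw [← Real.exp_add]; push_cast; ring_nf
    have h3 := Real.exp_le_exp.2 h1
    have := hM j
    calc _ ≤ Real.exp ((j : ℝ) - (N + 1 : ℕ)) * M j * Real.exp 1 := by gcongr
      _ = _ := by rw [h2]; ring
  · refine (hb j _).trans ?_
    have : (N : ℝ) ≤ j := by exact_mod_cast (by omega : N ≤ j)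
    have h1 : 1 ≤ Real.exp ((j : ℝ) - N) := Real.one_le_exp (by linarith)
    nlinarith [hM j]

theorem carl_chain (M : ℕ → ℝ) (hM : ∀ n, 0 < M n)
    (hmono : Monotone fun n => M (n + 1) / M n)
    (F : ℕ → ℝ → ℂ) (hF : ∀ n t, HasDerivAt (F n) (F (n + 1) t) t)
    (hb : ∀ n t, ‖F n t‖ ≤ M n) (K i : ℕ) : ∀ (x h : ℝ), 0 ≤ h →
    Real.exp 1 * h ≤ ∑ n ∈ Finset.range i, M (K + n) / M (K + n + 1) →
    (∀ j, ‖F j x‖ ≤ Real.exp ((j : ℝ) - (K + i : ℕ)) * M j) →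
    ∀ j, ‖F j (x + h)‖ ≤ Real.exp ((j : ℝ) - K) * M j := by
  have he := Real.exp_pos 1
  induction i with
  | zero =>
    intro x h h0 hh hP
    have : h = 0 := by
      simp at hh
      nlinarith
    subst this
    simpa using hP
  | succ i ih =>
    intro x h h0 hh hP
    rw [Finset.sum_range_succ] at hh
    have hr : 0 < M (K + i) / M (K + i + 1) := div_pos (hM _) (hM _)
    rcases le_total (Real.exp 1 * h) (M (K + i) / M (K + i + 1)) with hc | hc
    · have := carl_step M hM hmono F hF hb (K + i) x h h0 hc hP
      have := ih (x + h) 0 le_rfl (by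
        rw [mul_zero]
        exact Finset.sum_nonneg fun n _ => (div_pos (hM _) (hM _)).le) this
      simpa using this
    · set r := M (K + i) / M (K + i + 1) / Real.exp 1 with hrdef
      have hre : Real.exp 1 * r = M (K + i) / M (K + i + 1) := by
        rw [hrdef]; field_simp
      have := carl_step M hM hmono F hF hb (K + i) x r (by positivity) hre.le hP
      have := ih (x + r) (h - r) (by nlinarith) (by nlinarith) this
      simpa using this

theorem carl_bang (M : ℕ → ℝ) (hM : ∀ n, 0 < M n)
    (hmono : Monotone fun n => M (n + 1) / M n)
    (hns : ¬ Summable fun n => M n / M (n + 1))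
    (F : ℕ → ℝ → ℂ) (hF : ∀ n t, HasDerivAt (F n) (F (n + 1) t) t)
    (hb : ∀ n t, ‖F n t‖ ≤ M n) (hz : ∀ n, F n 0 = 0) (t : ℝ) (ht : 0 ≤ t) : F 0 t = 0 := by
  have hK : ∀ K : ℕ, ‖F 0 t‖ ≤ Real.exp (-(K : ℝ)) * M 0 := by
    intro K
    have hns' : ¬ Summable fun n => M (K + n) / M (K + n + 1) := by
      intro h
      apply hns
      rw [← summable_nat_add_iff K]
      simpa [add_comm, add_left_comm, add_assoc] using h
    rw [not_summable_iff_tendsto_nat_atTop_of_nonneg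
      (fun n => (div_pos (hM _) (hM _)).le)] at hns'
    obtain ⟨i, hi⟩ := (hns'.eventually_ge_atTop (Real.exp 1 * t)).exists
    have := carl_chain M hM hmono F hF hb K i 0 t ht hi (by
      intro j; rw [hz]; have := hM j; simp; positivity) 0
    simpa using this
  have hlim : Filter.Tendsto (fun K : ℕ => Real.exp (-(K : ℝ)) * M 0) Filter.atTop (nhds 0) := by
    have := (Real.tendsto_exp_neg_atTop_nhds_zero.comp
      (tendsto_natCast_atTop_atTop (R := ℝ))).mul_const (M 0)
    simpa using this
  exact norm_le_zero_iff.1 (ge_of_tendsto' hlim hK)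

theorem carl_sum (R : ℕ → ℝ) (hR : ∀ n, 0 ≤ R n) (hs : Summable R) :
    Summable fun n : ℕ => (∑ k ∈ Finset.range n, ((k : ℝ) + 1) * R k) / (n : ℝ) ^ 2 := by
  set T : ℕ → ℝ := fun n => ∑ k ∈ Finset.range n, ((k : ℝ) + 1) * R k with hT
  have hT0 : ∀ n, 0 ≤ T n := fun n => Finset.sum_nonneg fun k _ => by
    have := hR k; positivity
  have key : ∀ N : ℕ, ∑ n ∈ Finset.range (N + 1), T n / (n : ℝ) ^ 2 + T N / N
      ≤ 2 * ∑ k ∈ Finset.range N, R k := by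
    intro N
    induction N with
    | zero => simp [hT]
    | succ N ih =>
      rw [Finset.sum_range_succ, Finset.sum_range_succ (fun k => R k), mul_add]
      have hTs : T (N + 1) = T N + ((N : ℝ) + 1) * R N := by
        simp only [hT]; rw [Finset.sum_range_succ]
      have hq : T (N + 1) / ((N + 1 : ℕ) : ℝ) ^ 2 + T (N + 1) / ((N + 1 : ℕ) : ℝ)
          ≤ T N / N + 2 * R N := by
        have hN : (0 : ℝ) ≤ N := Nat.cast_nonneg N
        have e : T (N + 1) / ((N + 1 : ℕ) : ℝ) ^ 2 + T (N + 1) / ((N + 1 : ℕ) : ℝ)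
          = T N * (1 / ((N : ℝ) + 1) ^ 2 + 1 / ((N : ℝ) + 1)) + R N * (1 / ((N : ℝ) + 1) + 1) := by
          rw [hTs]; push_cast; field_simp
        rw [e]
        have h1 : 1 / ((N : ℝ) + 1) ≤ 1 := by
          rw [div_le_one (by positivity)]; linarith
        have h2 : R N * (1 / ((N : ℝ) + 1) + 1) ≤ 2 * R N := by nlinarith [hR N]
        have h3 : T N * (1 / ((N : ℝ) + 1) ^ 2 + 1 / ((N : ℝ) + 1)) ≤ T N / N := by
          rcases Nat.eq_zero_or_pos N with h | h
          · subst h; simp [hT]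
          · have hp : (0 : ℝ) < N := by exact_mod_cast h
            rw [div_eq_mul_one_div (T N)]
            refine mul_le_mul_of_nonneg_left ?_ (hT0 N)
            rw [div_add_div _ _ (by positivity) (by positivity),
              div_le_div_iff₀ (by positivity) hp]
            nlinarith [mul_pos hp hp]
        linarith
      linarith
  refine summable_of_sum_range_le (c := 2 * ∑' k, R k)
    (fun n => div_nonneg (hT0 n) (by positivity)) fun n => ?_
  have h1 := key n
  rw [Finset.sum_range_succ] at h1
  have h2 : 0 ≤ T n / (n : ℝ) ^ 2 := div_nonneg (hT0 n) (by positivity)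
  have h3 : 0 ≤ T n / n := div_nonneg (hT0 n) (by positivity)
  have h4 := hs.sum_le_tsum (Finset.range n) (fun k _ => hR k)
  change ∑ i ∈ Finset.range n, T i / (i : ℝ) ^ 2 ≤ _
  linarith

theorem carl_amgm (M : ℕ → ℝ) (hM : ∀ n, 0 < M n) (n : ℕ) (hn : 0 < n) :
    M 0 / M n ≤ (Real.exp 1 *
      ((∑ k ∈ Finset.range n, ((k : ℝ) + 1) * (M k / M (k + 1))) / (n : ℝ) ^ 2)) ^ n := by
  set T := ∑ k ∈ Finset.range n, ((k : ℝ) + 1) * (M k / M (k + 1)) with hT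
  have hn' : (0 : ℝ) < n := by exact_mod_cast hn
  have hnn : ∀ k : ℕ, 0 ≤ ((k : ℝ) + 1) * (M k / M (k + 1)) := fun k => by
    have := hM k; have := hM (k + 1); positivity
  have hT0 : 0 ≤ T := Finset.sum_nonneg fun k _ => hnn k
  have hprod : ∀ n : ℕ, ∏ k ∈ Finset.range n, ((k : ℝ) + 1) * (M k / M (k + 1))
      = (n.factorial : ℝ) * (M 0 / M n) := by
    intro n
    induction n with
    | zero => simp [(hM 0).ne']
    | succ n ih =>
      rw [Finset.prod_range_succ, ih, Nat.factorial_succ]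
      have := (hM n).ne'; have := (hM (n + 1)).ne'
      push_cast; field_simp
  have ag := Real.geom_mean_le_arith_mean (Finset.range n) (fun _ => 1)
    (fun k => ((k : ℝ) + 1) * (M k / M (k + 1))) (by simp) (by simpa using hn)
    (fun k _ => hnn k)
  simp only [Real.rpow_one, one_mul, Finset.sum_const, Finset.card_range, nsmul_eq_mul,
    mul_one] at ag
  rw [hprod, ← hT] at ag
  have hq : 0 < M 0 / M n := div_pos (hM _) (hM _)
  have ag2 : (n.factorial : ℝ) * (M 0 / M n) ≤ (T / n) ^ n := by
    have := pow_le_pow_left₀ (by positivity) ag n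
    rwa [Real.rpow_inv_natCast_pow (by positivity) hn.ne'] at this
  have hf : (n : ℝ) ^ n ≤ Real.exp 1 ^ n * n.factorial := by
    have := Real.pow_div_factorial_le_exp (n : ℝ) hn'.le n
    rw [div_le_iff₀ (by positivity)] at this
    rwa [← Real.exp_nat_mul, mul_one]
  have h1 : (n : ℝ) ^ n * (M 0 / M n) ≤ Real.exp 1 ^ n * (T / n) ^ n := by
    calc _ ≤ Real.exp 1 ^ n * n.factorial * (M 0 / M n) := by gcongr
      _ = Real.exp 1 ^ n * (n.factorial * (M 0 / M n)) := by ring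
      _ ≤ _ := by gcongr
  have h2 : (Real.exp 1 * (T / (n : ℝ) ^ 2)) ^ n = Real.exp 1 ^ n * (T / n) ^ n / (n : ℝ) ^ n := by
    rw [← mul_pow, ← div_pow]; congr 1; field_simp
  rw [h2, le_div_iff₀ (by positivity)]
  linarith

theorem carl_ns (M s : ℕ → ℝ) (hM : ∀ n, 0 < M n) (hs0 : 0 < s 0)
    (hMs : ∀ n, M (2 * n) = 2 * s (2 * n))
    (hcarl : ¬ Summable fun n : ℕ =>
      s (2 * (n + 1)) ^ (-(1 / (2 * ((n : ℝ) + 1))))) :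
    ¬ Summable fun n => M n / M (n + 1) := by
  intro hsum
  apply hcarl
  have hS := carl_sum _ (fun n => (div_pos (hM _) (hM _)).le) hsum
  have hinj : Function.Injective fun m : ℕ => 2 * (m + 1) := fun a b h => by
    simp at h; omega
  have hS2 := (hS.comp_injective hinj).mul_left (max 1 (1 / s 0) * Real.exp 1)
  have hsp : ∀ n, 0 < s (2 * n) := fun n => by
    have := hM (2 * n); rw [hMs] at this; linarith
  refine Summable.of_nonneg_of_le (fun m => Real.rpow_nonneg (hsp (m + 1)).le _) ?_ hS2
  intro m
  have ha := carl_amgm M hM (2 * (m + 1)) (by omega)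
  simp only [Function.comp]
  set u := (∑ k ∈ Finset.range (2 * (m + 1)), ((k : ℝ) + 1) * (M k / M (k + 1)))
    / ((2 * (m + 1) : ℕ) : ℝ) ^ 2 with hu
  have hu0 : 0 ≤ u := div_nonneg (Finset.sum_nonneg fun k _ => by
    have := hM k; have := hM (k + 1); positivity) (by positivity)
  have hM0 : M 0 = 2 * s 0 := hMs 0
  rw [hM0, hMs, mul_div_mul_left _ _ two_ne_zero] at ha
  set n := 2 * (m + 1) with hn
  have hsn : 0 < s n := hsp (m + 1)
  set C := max 1 (1 / s 0) with hC
  have hC1 : 1 ≤ C := le_max_left _ _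
  have hC2 : 1 / s 0 ≤ C ^ n := (le_max_right _ _).trans (le_self_pow₀ hC1 (by omega))
  have hinv : (s n)⁻¹ ≤ (C * Real.exp 1 * u) ^ n := by
    calc (s n)⁻¹ = 1 / s 0 * (s 0 / s n) := by field_simp
      _ ≤ C ^ n * (Real.exp 1 * u) ^ n := by gcongr
      _ = _ := by rw [← mul_pow, mul_assoc]
  have hexp : (2 * ((m : ℝ) + 1)) = (n : ℝ) := by rw [hn]; push_cast; ring
  rw [hexp, Real.rpow_neg hsn.le, ← Real.inv_rpow hsn.le, one_div]
  calc _ ≤ ((C * Real.exp 1 * u) ^ n) ^ ((n : ℝ)⁻¹) :=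
        Real.rpow_le_rpow (by positivity) hinv (by positivity)
    _ = _ := Real.pow_rpow_inv_natCast (by positivity) (by omega)

theorem carl_abs_int {μ : Measure ℝ} {s : ℕ → ℝ} (h : HasMoments μ s) (n : ℕ) :
    Integrable (fun x : ℝ => |x| ^ n) μ := by
  simpa [abs_pow] using (h n).1.abs

theorem carl_deriv {μ : Measure ℝ} {s : ℕ → ℝ} (h : HasMoments μ s) (n : ℕ) (t : ℝ) :
    HasDerivAt (fun t : ℝ => ∫ x : ℝ, (x * Complex.I) ^ n * Complex.exp (t * x * Complex.I) ∂μ)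
      (∫ x : ℝ, (x * Complex.I) ^ (n + 1) * Complex.exp (t * x * Complex.I) ∂μ) t := by
  have hnorm : ∀ (n : ℕ) (t x : ℝ),
      ‖((x : ℂ) * Complex.I) ^ n * Complex.exp (t * x * Complex.I)‖ = |x| ^ n := by
    intro n t x
    rw [norm_mul, ← Complex.ofReal_mul, Complex.norm_exp_ofReal_mul_I]
    simp
  have hmeas : ∀ (n : ℕ) (t : ℝ), AEStronglyMeasurable
      (fun x : ℝ => ((x : ℂ) * Complex.I) ^ n * Complex.exp (t * x * Complex.I)) μ := by
    intro n t
    exact (by fun_prop : Continuous fun x : ℝ =>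
      ((x : ℂ) * Complex.I) ^ n * Complex.exp (t * x * Complex.I)).aestronglyMeasurable
  refine (hasDerivAt_integral_of_dominated_loc_of_deriv_le (s := Set.univ)
    (F := fun t x : ℝ => ((x : ℂ) * Complex.I) ^ n * Complex.exp (t * x * Complex.I))
    (F' := fun t x : ℝ => ((x : ℂ) * Complex.I) ^ (n + 1) * Complex.exp (t * x * Complex.I))
    (bound := fun x : ℝ => |x| ^ (n + 1)) Filter.univ_mem
    (Filter.Eventually.of_forall fun t => hmeas n t) ?_ (hmeas _ _) ?_
    (carl_abs_int h (n + 1)) ?_).2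
  · refine (carl_abs_int h n).mono' (hmeas n t) (Filter.Eventually.of_forall fun x => ?_)
    exact (hnorm n t x).le
  · exact Filter.Eventually.of_forall fun x t _ => (hnorm (n + 1) t x).le
  · refine Filter.Eventually.of_forall fun x t _ => ?_
    have h1 : HasDerivAt (fun t : ℝ => (t : ℂ) * x * Complex.I) (x * Complex.I) t := by
      have := ((Complex.ofRealCLM.hasDerivAt (x := t)).mul_const (x : ℂ)).mul_const Complex.I
      simpa using this
    have h2 := (h1.cexp).const_mul (((x : ℂ) * Complex.I) ^ n)
    exact h2.congr_deriv (by ring)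

theorem carl_bound {μ : Measure ℝ} {s : ℕ → ℝ} (_h : HasMoments μ s) (n : ℕ) (t : ℝ) :
    ‖∫ x : ℝ, (x * Complex.I) ^ n * Complex.exp (t * x * Complex.I) ∂μ‖ ≤ ∫ x, |x| ^ n ∂μ := by
  refine (norm_integral_le_integral_norm _).trans (le_of_eq ?_)
  congr 1
  ext x
  rw [norm_mul, ← Complex.ofReal_mul, Complex.norm_exp_ofReal_mul_I]
  simp

theorem carl_zero {μ : Measure ℝ} {s : ℕ → ℝ} (h : HasMoments μ s) (n : ℕ) :
    ∫ x : ℝ, (x * Complex.I) ^ n * Complex.exp ((0 : ℝ) * x * Complex.I) ∂μ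
      = s n * Complex.I ^ n := by
  rw [(h n).2, ← integral_complex_ofReal, ← integral_mul_const]
  congr 1
  ext x
  simp [mul_pow]

theorem carleman_hamburger (s : ℕ → ℝ)
    (hmom : ∃ μ : Measure ℝ, IsRadon μ ∧ HasMoments μ s)
    (hcarl : ¬ Summable fun n : ℕ =>
      s (2 * (n + 1)) ^ (-(1 / (2 * ((n : ℝ) + 1))))) :
    ∀ μ ν : Measure ℝ, IsRadon μ → IsRadon ν → HasMoments μ s → HasMoments ν s → μ = ν := by
  intro μ ν _ _ hμ hν
  have hfin : ∀ {ρ : Measure ℝ}, HasMoments ρ s → IsFiniteMeasure ρ := by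
    intro ρ h
    have := (h 0).1
    simp only [pow_zero] at this
    rcases integrable_const_iff.1 this with h | h
    · simp at h
    · exact h
  have := hfin hμ
  have := hfin hν
  set M : ℕ → ℝ := fun n => ∫ x, |x| ^ n ∂(μ + ν) with hMdef
  have hint : ∀ n, Integrable (fun x : ℝ => |x| ^ n) (μ + ν) := fun n =>
    (carl_abs_int hμ n).add_measure (carl_abs_int hν n)
  have hMadd : ∀ n, M n = (∫ x, |x| ^ n ∂μ) + ∫ x, |x| ^ n ∂ν := fun n =>
    integral_add_measure (carl_abs_int hμ n) (carl_abs_int hν n)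
  have hMs : ∀ n, M (2 * n) = 2 * s (2 * n) := by
    intro n
    rw [hMadd]
    have e : ∀ x : ℝ, |x| ^ (2 * n) = x ^ (2 * n) := fun x => by rw [pow_mul, sq_abs, ← pow_mul]
    simp only [e]
    rw [← (hμ _).2, ← (hν _).2]; ring
  have hM : ∀ n, 0 < M n := by
    intro n
    refine lt_of_le_of_ne (integral_nonneg fun x => by positivity) fun h0 => hcarl ?_
    have hae := (integral_eq_zero_iff_of_nonneg (fun x => by positivity) (hint n)).1 h0.symm
    have hz : ∀ m, s (2 * (m + 1)) = 0 := by
      intro m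
      have : M (2 * (m + 1)) = 0 := by
        refine integral_eq_zero_of_ae ?_
        filter_upwards [hae] with x hx
        have : |x| = 0 := eq_zero_of_pow_eq_zero hx
        simp [this]
      rw [hMs] at this; linarith
    have : (fun n : ℕ => s (2 * (n + 1)) ^ (-(1 / (2 * ((n : ℝ) + 1))))) = fun _ => 0 := by
      ext m
      rw [hz, Real.zero_rpow]
      have : (0 : ℝ) < 1 / (2 * ((m : ℝ) + 1)) := by positivity
      exact (neg_lt_zero.2 this).ne
    rw [this]; exact summable_zero
  have hlc : ∀ n, M (n + 1) ^ 2 ≤ M n * M (n + 2) := by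
    intro n
    have h1 : 0 ≤ ∫ x, |x| ^ n * (M (n + 1) - M n * |x|) ^ 2 ∂(μ + ν) :=
      integral_nonneg fun x => by positivity
    have e : ∀ x : ℝ, |x| ^ n * (M (n + 1) - M n * |x|) ^ 2
        = M (n + 1) ^ 2 * |x| ^ n - 2 * M (n + 1) * M n * |x| ^ (n + 1)
          + M n ^ 2 * |x| ^ (n + 2) := fun x => by ring
    simp only [e] at h1
    have hi : Integrable (fun x : ℝ => M (n + 1) ^ 2 * |x| ^ n
        - 2 * M (n + 1) * M n * |x| ^ (n + 1)) (μ + ν) :=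
      ((hint n).const_mul _).sub ((hint (n + 1)).const_mul _)
    rw [integral_add hi ((hint (n + 2)).const_mul _),
      integral_sub ((hint n).const_mul _) ((hint (n + 1)).const_mul _),
      integral_const_mul, integral_const_mul, integral_const_mul] at h1
    change 0 ≤ M (n + 1) ^ 2 * M n - 2 * M (n + 1) * M n * M (n + 1) + M n ^ 2 * M (n + 2) at h1
    have h2 : 0 ≤ M n * (M n * M (n + 2) - M (n + 1) ^ 2) := by linarith
    have := (mul_nonneg_iff_of_pos_left (hM n)).1 h2
    linarith
  have hmono : Monotone fun n => M (n + 1) / M n := by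
    refine monotone_nat_of_le_succ fun n => ?_
    rw [div_le_div_iff₀ (hM _) (hM _)]
    have := hlc n
    change M (n + 1) * M (n + 1) ≤ M (n + 2) * M n
    linarith
  have hs0 : 0 < s 0 := by
    have h1 := hM 0
    have h2 := hMs 0
    simp only [mul_zero] at h2
    linarith
  have hns := carl_ns M s hM hs0 hMs hcarl
  set F : ℕ → ℝ → ℂ := fun n t =>
    (∫ x : ℝ, (x * Complex.I) ^ n * Complex.exp (t * x * Complex.I) ∂μ)
    - ∫ x : ℝ, (x * Complex.I) ^ n * Complex.exp (t * x * Complex.I) ∂ν with hFdef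
  have hF : ∀ n t, HasDerivAt (F n) (F (n + 1) t) t := fun n t =>
    (carl_deriv hμ n t).sub (carl_deriv hν n t)
  have hb : ∀ n t, ‖F n t‖ ≤ M n := fun n t => by
    rw [hMadd]
    exact (norm_sub_le _ _).trans (add_le_add (carl_bound hμ n t) (carl_bound hν n t))
  have hz : ∀ n, F n 0 = 0 := fun n => by
    simp only [hFdef]
    rw [carl_zero hμ, carl_zero hν, sub_self]
  have hpos := carl_bang M hM hmono hns F hF hb hz
  have hneg := carl_bang M hM hmono hns (fun n t => (-1) ^ n * F n (-t))
    (fun n t => by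
      have h1 := ((hF n (-t)).scomp t (hasDerivAt_neg t)).const_mul ((-1 : ℂ) ^ n)
      exact h1.congr_deriv (by simp [pow_succ]))
    (fun n t => by simpa using hb n (-t)) (fun n => by simp [hz])
  have hall : ∀ t, F 0 t = 0 := by
    intro t
    rcases le_total 0 t with h | h
    · exact hpos t h
    · simpa using hneg (-t) (by linarith)
  refine Measure.ext_of_charFun (funext fun t => ?_)
  rw [charFun_apply_real, charFun_apply_real]
  have := hall t
  simp only [hFdef, pow_zero, one_mul] at this
  exact sub_eq_zero.1 this
end

section
/- Carleman's theorem for the Stieltjes moment problem: Let s = (s_n)_{n∈ℕ₀} be a Stieltjes moment sequence satisfying ∑_{n=1}^∞ s_n^{−1/(2n)} = +∞ (with the convention 0^{−1/(2n)} = 0). Then s is a determinate Stieltjes moment sequence: any two Radon measures μ, ν on ℝ supported on [0,+∞) such that every x^n is integrable and ∫ x^n dμ = ∫ x^n dν = s_n for all n ∈ ℕ₀ are equal. -/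
open MeasureTheory

/-- `μ` is a measure on `[0,∞)` with moment sequence `s`. -/
def IsStieltjesRepr (μ : Measure ℝ) (s : ℕ → ℝ) : Prop :=
  μ (Set.Iio (0 : ℝ)) = 0 ∧
  ∀ n : ℕ, Integrable (fun x : ℝ => x ^ n) μ ∧ s n = ∫ x : ℝ, x ^ n ∂μ



lemma bang_aux (F : ℕ → ℝ → ℝ) (M r : ℕ → ℝ) (hM : ∀ j, 0 < M j) (hr : ∀ j, 0 < r j)
    (hrm : Monotone r) (hMr : ∀ j, M (j + 1) = r j * M j)
    (hF : ∀ j t, HasDerivAt (F j) (F (j + 1) t) t) (hb : ∀ j t, |F j t| ≤ M j)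
    (h0 : ∀ j, F j 0 = 0) (d : ℕ) : ∀ (k : ℕ) (x : ℝ), 0 ≤ x →
      x ≤ ∑ i ∈ Finset.range d, 1 / (Real.exp 1 * r (k + i)) → ∀ j ≤ k,
      |F j x| ≤ Real.exp ((j : ℝ) - k) * M j := by
  induction d with
  | zero =>
    intro k x hx0 hx j hj
    have : x = 0 := by simp at hx; linarith
    subst this
    rw [h0, abs_zero]
    have := hM j
    positivity
  | succ d ih =>
    intro k x hx0 hx j hj
    have hek : 0 < Real.exp 1 * r k := mul_pos (Real.exp_pos _) (hr k)
    set h := 1 / (Real.exp 1 * r k) with hh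
    have hhpos : 0 < h := by positivity
    have hS : 0 ≤ ∑ i ∈ Finset.range d, 1 / (Real.exp 1 * r (k + 1 + i)) :=
      Finset.sum_nonneg fun i _ => by have := hr (k + 1 + i); positivity
    obtain ⟨x0, hx00, hx0x, hxh, hx0S⟩ : ∃ x0, 0 ≤ x0 ∧ x0 ≤ x ∧ x ≤ x0 + h ∧
        x0 ≤ ∑ i ∈ Finset.range d, 1 / (Real.exp 1 * r (k + 1 + i)) := by
      refine ⟨max 0 (x - h), le_max_left _ _, max_le hx0 (by linarith), ?_, max_le hS ?_⟩
      · linarith [le_max_right 0 (x - h)]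
      · rw [Finset.sum_range_succ'] at hx
        have h5 : ∑ i ∈ Finset.range d, 1 / (Real.exp 1 * r (k + (i + 1))) =
            ∑ i ∈ Finset.range d, 1 / (Real.exp 1 * r (k + 1 + i)) :=
          Finset.sum_congr rfl fun i _ => by rw [show k + (i + 1) = k + 1 + i by ring]
        rw [h5, add_zero] at hx
        linarith
    have ih' := ih (k + 1) x0 hx00 hx0S
    have key : ∀ i j, j + i = k + 1 → ∀ y ∈ Set.Icc x0 x,
        |F j y| ≤ Real.exp ((j : ℝ) - (k + 1 : ℕ)) * M j *
          Real.exp (Real.exp 1 * r k * (y - x0)) := by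
      intro i
      induction i with
      | zero =>
        intro j hj y hy
        have hj' : j = k + 1 := by omega
        subst hj'
        have h1 : 1 ≤ Real.exp (Real.exp 1 * r k * (y - x0)) :=
          Real.one_le_exp (mul_nonneg hek.le (by linarith [hy.1]))
        rw [sub_self, Real.exp_zero, one_mul]
        nlinarith [hb (k + 1) y, hM (k + 1)]
      | succ i ihi =>
        intro j hj
        have hjk : j ≤ k := by omega
        have ih2 := ihi (j + 1) (by omega)
        refine image_norm_le_of_norm_deriv_right_le_deriv_boundary (f := F j) (f' := F (j + 1))
          (B := fun y => Real.exp ((j : ℝ) - (k + 1 : ℕ)) * M j *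
          Real.exp (Real.exp 1 * r k * (y - x0)))
          (B' := fun y => Real.exp ((j : ℝ) - (k + 1 : ℕ)) * M j *
          (Real.exp (Real.exp 1 * r k * (y - x0)) * (Real.exp 1 * r k)))
          (fun y _ => (hF j y).continuousAt.continuousWithinAt)
          (fun y _ => (hF j y).hasDerivWithinAt) ?_ ?_ ?_
        · have := ih' j (by omega)
          simpa using this
        · intro y
          have := ((((hasDerivAt_id y).sub_const x0).const_mul
            (Real.exp 1 * r k)).exp).const_mul (Real.exp ((j : ℝ) - (k + 1 : ℕ)) * M j)
          simpa using this
        · intro y hy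
          refine (ih2 y ⟨hy.1, hy.2.le⟩).trans ?_
          have e1 : Real.exp (((j + 1 : ℕ) : ℝ) - (k + 1 : ℕ)) =
              Real.exp ((j : ℝ) - (k + 1 : ℕ)) * Real.exp 1 := by
            rw [← Real.exp_add]; congr 1; push_cast; ring
          rw [e1, hMr j]
          have := hrm hjk
          have p1 := hM j
          calc _ = (Real.exp ((j : ℝ) - (k + 1 : ℕ)) * M j *
            Real.exp (Real.exp 1 * r k * (y - x0)) * Real.exp 1) * r j := by ring
            _ ≤ (Real.exp ((j : ℝ) - (k + 1 : ℕ)) * M j *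
            Real.exp (Real.exp 1 * r k * (y - x0)) * Real.exp 1) * r k := by gcongr
            _ = _ := by ring
    have := key (k + 1 - j) j (by omega) x ⟨hx0x, le_rfl⟩
    refine this.trans ?_
    have e2 : Real.exp (Real.exp 1 * r k * (x - x0)) ≤ Real.exp 1 := by
      apply Real.exp_le_exp.2
      calc _ ≤ Real.exp 1 * r k * h := by gcongr; linarith
        _ = 1 := by rw [hh]; exact mul_one_div_cancel hek.ne'
    have p1 := hM j
    calc _ ≤ Real.exp ((j : ℝ) - (k + 1 : ℕ)) * M j * Real.exp 1 := by gcongr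
      _ = (Real.exp ((j : ℝ) - (k + 1 : ℕ)) * Real.exp 1) * M j := by ring
      _ = _ := by
        rw [← Real.exp_add]; congr 2; push_cast; ring

lemma bang (F : ℕ → ℝ → ℝ) (M r : ℕ → ℝ) (hM : ∀ j, 0 < M j) (hr : ∀ j, 0 < r j)
    (hrm : Monotone r) (hMr : ∀ j, M (j + 1) = r j * M j)
    (hF : ∀ j t, HasDerivAt (F j) (F (j + 1) t) t) (hb : ∀ j t, |F j t| ≤ M j)
    (h0 : ∀ j, F j 0 = 0) (hs : ¬ Summable fun n => 1 / r n) (x : ℝ) (hx : 0 ≤ x) :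
    F 0 x = 0 := by
  have h1 : ∀ k : ℕ, |F 0 x| ≤ Real.exp (-(k : ℝ)) * M 0 := by
    intro k
    have h2 : ¬ Summable fun n => 1 / (Real.exp 1 * r (k + n)) := by
      intro h
      apply hs
      rw [← summable_nat_add_iff k]
      refine (h.mul_left (Real.exp 1)).congr fun n => ?_
      have := hr (k + n)
      rw [add_comm n k]
      field_simp
    have h3 := (not_summable_iff_tendsto_nat_atTop_of_nonneg (fun n => by
      have := hr (k + n); positivity)).1 h2
    obtain ⟨d, hd⟩ := (h3.eventually_ge_atTop x).exists
    simpa using bang_aux F M r hM hr hrm hMr hF hb h0 d k x hx hd 0 (Nat.zero_le _)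
  have h4 : Filter.Tendsto (fun k : ℕ => Real.exp (-(k : ℝ)) * M 0) Filter.atTop (nhds 0) := by
    have := (Real.tendsto_exp_neg_atTop_nhds_zero.comp
      (tendsto_natCast_atTop_atTop (R := ℝ))).mul_const (M 0)
    simpa using this
  have := ge_of_tendsto' h4 h1
  simpa using le_antisymm this (abs_nonneg _)

lemma carleman_ineq (b : ℕ → ℝ) (hb : ∀ n, 0 < b n) (hs : Summable b) :
    Summable fun n : ℕ => (∏ i ∈ Finset.range (n + 1), b i) ^ (1 / ((n : ℝ) + 1)) := by
  have hterm : ∀ n : ℕ, (∏ i ∈ Finset.range (n + 1), b i) ^ (1 / ((n : ℝ) + 1)) ≤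
      Real.exp 1 * ∑ i ∈ Finset.range (n + 1), ((i : ℝ) + 1) * b i * (((n + 1 : ℕ) : ℝ) ^ 2)⁻¹ := by
    intro n
    have hz : ∀ i : ℕ, 0 < ((i : ℝ) + 1) * b i := fun i => by have := hb i; positivity
    have amgm := Real.geom_mean_le_arith_mean (Finset.range (n + 1)) (fun _ => 1)
      (fun i => ((i : ℝ) + 1) * b i) (by simp) (by simp; positivity) (fun i _ => (hz i).le)
    simp only [Real.rpow_one, Finset.sum_const, Finset.card_range, nsmul_eq_mul, mul_one,
      one_mul] at amgm
    have hprod : ∏ i ∈ Finset.range (n + 1), (((i : ℝ) + 1) * b i) =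
        ((n + 1).factorial : ℝ) * ∏ i ∈ Finset.range (n + 1), b i := by
      rw [Finset.prod_mul_distrib]
      congr 1
      rw [← Finset.prod_range_add_one_eq_factorial]
      push_cast; rfl
    have hfac := Real.pow_div_factorial_le_exp (x := ((n + 1 : ℕ) : ℝ)) (by positivity) (n + 1)
    have hpb : 0 < ∏ i ∈ Finset.range (n + 1), b i := Finset.prod_pos fun i _ => hb i
    have hN : (0 : ℝ) < ((n + 1 : ℕ) : ℝ) := by positivity
    set N : ℝ := ((n + 1 : ℕ) : ℝ) with hNdef
    have hpz : 0 ≤ ∏ i ∈ Finset.range (n + 1), (((i : ℝ) + 1) * b i) :=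
      Finset.prod_nonneg fun i _ => (hz i).le
    have hle : ∏ i ∈ Finset.range (n + 1), b i ≤
        (∏ i ∈ Finset.range (n + 1), (((i : ℝ) + 1) * b i)) * (Real.exp 1 / N) ^ (n + 1) := by
      rw [hprod, div_pow, ← Real.exp_nat_mul, mul_one, ← hNdef]
      have hf : (0 : ℝ) < (n + 1).factorial := by positivity
      rw [div_le_iff₀ hf] at hfac
      rw [mul_div_assoc', le_div_iff₀ (by positivity)]
      nlinarith
    have e : 1 / ((n : ℝ) + 1) = N⁻¹ := by rw [hNdef]; push_cast; rw [one_div]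
    rw [e]
    calc _ ≤ ((∏ i ∈ Finset.range (n + 1), (((i : ℝ) + 1) * b i)) *
            (Real.exp 1 / N) ^ (n + 1)) ^ N⁻¹ := by gcongr
      _ = (∏ i ∈ Finset.range (n + 1), (((i : ℝ) + 1) * b i)) ^ N⁻¹ * (Real.exp 1 / N) := by
        rw [Real.mul_rpow hpz (by positivity), hNdef, Real.pow_rpow_inv_natCast (by positivity)
          (by omega)]
      _ ≤ (∑ i ∈ Finset.range (n + 1), (((i : ℝ) + 1) * b i)) / N * (Real.exp 1 / N) := by
        gcongr
      _ = _ := by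
        rw [← Finset.sum_mul]; field_simp
  refine summable_of_sum_range_le (c := Real.exp 1 * (2 * ∑' i, b i))
    (fun n => Real.rpow_nonneg (Finset.prod_nonneg fun i _ => (hb i).le) _) fun n => ?_
  refine (Finset.sum_le_sum fun i _ => hterm i).trans ?_
  rw [← Finset.mul_sum]
  gcongr
  rw [Finset.sum_comm' (t' := Finset.range n) (s' := fun i => Finset.Ico i n)
    (by intro x y; simp; omega)]
  calc _ ≤ ∑ i ∈ Finset.range n, 2 * b i := by
        refine Finset.sum_le_sum fun i _ => ?_
        rw [← Finset.mul_sum]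
        have h1 : ∑ m ∈ Finset.Ico i n, (((m + 1 : ℕ) : ℝ) ^ 2)⁻¹ ≤ 2 / ((i : ℝ) + 1) := by
          refine le_trans (le_of_eq ?_) (sum_Ioo_inv_sq_le (α := ℝ) i (n + 1))
          rw [Finset.sum_Ico_add' (fun m : ℕ => ((m : ℝ) ^ 2)⁻¹) i n 1]
          apply Finset.sum_congr _ (fun _ _ => rfl)
          ext; simp; try omega
        have := hb i
        calc _ ≤ ((i : ℝ) + 1) * b i * (2 / ((i : ℝ) + 1)) := by gcongr
          _ = _ := by field_simp
    _ = 2 * ∑ i ∈ Finset.range n, b i := by rw [Finset.mul_sum]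
    _ ≤ _ := by
      gcongr
      exact hs.sum_le_tsum _ (fun i _ => (hb i).le)

lemma repr_finite {μ : Measure ℝ} {s : ℕ → ℝ} (h : IsStieltjesRepr μ s) : IsFiniteMeasure μ := by
  have := (h.2 0).1
  simp only [pow_zero] at this
  exact (integrable_const_iff_isFiniteMeasure one_ne_zero).1 this

lemma repr_ae {μ : Measure ℝ} {s : ℕ → ℝ} (h : IsStieltjesRepr μ s) : ∀ᵐ x ∂μ, 0 ≤ x := by
  rw [ae_iff]
  convert h.1 using 2
  ext; simp

lemma int_sqrt {μ : Measure ℝ} {s : ℕ → ℝ} (h : IsStieltjesRepr μ s) (j : ℕ) :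
    Integrable (fun x : ℝ => √x ^ j) μ := by
  have := repr_finite h
  refine Integrable.mono' ((integrable_const (1 : ℝ)).add (h.2 j).1.norm)
    (by fun_prop) ?_
  filter_upwards [repr_ae h] with x hx
  have h1 : 0 ≤ ‖x ^ j‖ := norm_nonneg _
  simp only [Pi.add_apply]
  rw [Real.norm_of_nonneg (by positivity)]
  rcases le_total x 1 with hx1 | hx1
  · have : √x ^ j ≤ 1 := pow_le_one₀ (by positivity) (by simpa using hx1)
    linarith
  · have h2 : √x ≤ x := by
      rw [Real.sqrt_le_left (by linarith)]; nlinarith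
    have : √x ^ j ≤ x ^ j := by gcongr
    linarith [Real.le_norm_self (x ^ j)]

lemma even_mom {μ : Measure ℝ} {s : ℕ → ℝ} (h : IsStieltjesRepr μ s) (n : ℕ) :
    ∫ x, √x ^ (2 * n) ∂μ = s n := by
  rw [(h.2 n).2]
  apply integral_congr_ae
  filter_upwards [repr_ae h] with x hx
  rw [pow_mul, Real.sq_sqrt hx]

lemma cs_mom {μ : Measure ℝ} {s : ℕ → ℝ} (h : IsStieltjesRepr μ s) (a c : ℕ) :
    (∫ x, √x ^ (a + c) ∂μ) ^ 2 ≤ (∫ x, √x ^ a ∂μ) * ∫ x, √x ^ (a + 2 * c) ∂μ := by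
  have hd := discrim_le_zero (K := ℝ) (a := ∫ x, √x ^ a ∂μ) (b := 2 * ∫ x, √x ^ (a + c) ∂μ)
    (c := ∫ x, √x ^ (a + 2 * c) ∂μ) (fun t => by
      have h1 : 0 ≤ ∫ x, √x ^ a * (t + √x ^ c) ^ 2 ∂μ :=
        integral_nonneg fun x => by positivity
      have h2 : ∫ x, √x ^ a * (t + √x ^ c) ^ 2 ∂μ =
          ∫ x, ((t * t) * √x ^ a + (2 * t) * √x ^ (a + c) + √x ^ (a + 2 * c)) ∂μ := by
        congr 1; ext x; ring
      have h3 : Integrable (fun x => (t * t) * √x ^ a + (2 * t) * √x ^ (a + c)) μ :=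
        ((int_sqrt h _).const_mul _).add ((int_sqrt h _).const_mul _)
      rw [integral_add h3 (int_sqrt h _), integral_add ((int_sqrt h _).const_mul _) ((int_sqrt h _).const_mul _),
        integral_const_mul, integral_const_mul] at h2
      rw [h2] at h1
      linarith)
  unfold discrim at hd
  nlinarith

lemma mom_nonneg {μ : Measure ℝ} {s : ℕ → ℝ} (h : IsStieltjesRepr μ s) (n : ℕ) : 0 ≤ s n := by
  rw [← even_mom h]
  exact integral_nonneg fun x => by positivity

lemma log_convex {μ : Measure ℝ} {s : ℕ → ℝ} (h : IsStieltjesRepr μ s) (n : ℕ) :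
    s (n + 1) ^ 2 ≤ s n * s (n + 2) := by
  have := cs_mom h (2 * n) 2
  rw [show 2 * n + 2 = 2 * (n + 1) by ring, show 2 * n + 2 * 2 = 2 * (n + 2) by ring,
    even_mom h, even_mom h, even_mom h] at this
  exact this

lemma mom_le {μ : Measure ℝ} {s : ℕ → ℝ} (h : IsStieltjesRepr μ s) (j : ℕ) :
    ∫ x, √x ^ j ∂μ ≤ √(s (j / 2) * s ((j + 1) / 2)) := by
  apply Real.le_sqrt_of_sq_le
  rcases Nat.even_or_odd' j with ⟨n, rfl | rfl⟩
  · rw [show 2 * n / 2 = n by omega, show (2 * n + 1) / 2 = n by omega, even_mom h, sq]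
  · rw [show (2 * n + 1) / 2 = n by omega, show (2 * n + 1 + 1) / 2 = n + 1 by omega]
    have := cs_mom h (2 * n) 1
    rw [show 2 * n + 2 * 1 = 2 * (n + 1) by ring, even_mom h, even_mom h] at this
    exact this

noncomputable def cosT (μ : Measure ℝ) (j : ℕ) (t : ℝ) : ℝ :=
  ∫ x, √x ^ j * Real.cos (t * √x + j * (Real.pi / 2)) ∂μ

lemma cosT_int {μ : Measure ℝ} {s : ℕ → ℝ} (h : IsStieltjesRepr μ s) (j : ℕ) (t : ℝ) :
    Integrable (fun x => √x ^ j * Real.cos (t * √x + j * (Real.pi / 2))) μ := by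
  refine Integrable.mono' (int_sqrt h j) (by fun_prop) (ae_of_all _ fun x => ?_)
  rw [norm_mul, Real.norm_of_nonneg (by positivity : 0 ≤ √x ^ j)]
  exact mul_le_of_le_one_right (by positivity) (Real.abs_cos_le_one _)

lemma cosT_bound {μ : Measure ℝ} {s : ℕ → ℝ} (h : IsStieltjesRepr μ s) (j : ℕ) (t : ℝ) :
    |cosT μ j t| ≤ √(s (j / 2) * s ((j + 1) / 2)) := by
  refine le_trans ?_ (mom_le h j)
  refine norm_integral_le_of_norm_le (G := ℝ) (int_sqrt h j) (ae_of_all _ fun x => ?_)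
  rw [norm_mul, Real.norm_of_nonneg (by positivity : 0 ≤ √x ^ j)]
  exact mul_le_of_le_one_right (by positivity) (Real.abs_cos_le_one _)

lemma cosT_deriv {μ : Measure ℝ} {s : ℕ → ℝ} (h : IsStieltjesRepr μ s) (j : ℕ) (t : ℝ) :
    HasDerivAt (cosT μ j) (cosT μ (j + 1) t) t := by
  refine (hasDerivAt_integral_of_dominated_loc_of_deriv_le (𝕜 := ℝ) (E := ℝ) (μ := μ) (s := Set.univ)
    (F := fun (t x : ℝ) => √x ^ j * Real.cos (t * √x + j * (Real.pi / 2)))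
    (F' := fun t x => √x ^ (j + 1) * Real.cos (t * √x + (j + 1 : ℕ) * (Real.pi / 2)))
    (bound := fun x => √x ^ (j + 1)) Filter.univ_mem
    (Filter.Eventually.of_forall fun t => (cosT_int h j t).aestronglyMeasurable) (cosT_int h j t)
    (cosT_int h (j + 1) t).aestronglyMeasurable (ae_of_all _ fun x t _ => ?_) (int_sqrt h (j + 1))
    (ae_of_all _ fun x t _ => ?_)).2
  · rw [norm_mul, Real.norm_of_nonneg (by positivity : 0 ≤ √x ^ (j + 1))]
    exact mul_le_of_le_one_right (by positivity) (Real.abs_cos_le_one _)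
  · have h1 := ((((hasDerivAt_id t).mul_const (√x)).add_const
      (j * (Real.pi / 2))).cos).const_mul (√x ^ j)
    refine h1.congr_deriv ?_
    rw [show t * √x + (j + 1 : ℕ) * (Real.pi / 2) = (t * √x + j * (Real.pi / 2)) + Real.pi / 2 by
      push_cast; ring, Real.cos_add_pi_div_two]
    simp only [id]
    ring

lemma cosT_zero {μ ν : Measure ℝ} {s : ℕ → ℝ} (h : IsStieltjesRepr μ s)
    (h' : IsStieltjesRepr ν s) (j : ℕ) : cosT μ j 0 = cosT ν j 0 := by
  unfold cosT
  simp only [zero_mul, zero_add]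
  rw [integral_mul_const, integral_mul_const]
  rcases Nat.even_or_odd' j with ⟨n, rfl | rfl⟩
  · rw [even_mom h, even_mom h']
  · have : Real.cos (((2 * n + 1 : ℕ) : ℝ) * (Real.pi / 2)) = 0 := by
      rw [Real.cos_eq_zero_iff]
      exact ⟨n, by push_cast; ring⟩
    rw [this]; simp

lemma charFun_symm {μ : Measure ℝ} {s : ℕ → ℝ} (h : IsStieltjesRepr μ s) (t : ℝ) :
    charFun (μ.map (fun x => √x) + μ.map (fun x => -√x)) t = ((2 * cosT μ 0 |t| : ℝ) : ℂ) := by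
  have := repr_finite h
  have hi : ∀ f : ℝ → ℝ, Measurable f → ∀ ρ : Measure ℝ, IsFiniteMeasure ρ →
      Integrable (fun x => Complex.exp (t * f x * Complex.I)) ρ := by
    intro f hf ρ _
    refine Integrable.mono' (integrable_const (1 : ℝ)) (by fun_prop) (ae_of_all _ fun x => ?_)
    rw [← Complex.ofReal_mul, Complex.norm_exp_ofReal_mul_I]
  have f1 : IsFiniteMeasure (μ.map (fun x => √x)) := inferInstance
  have f2 : IsFiniteMeasure (μ.map (fun x => -√x)) := inferInstance
  have i1 : Integrable (fun x : ℝ => Complex.exp (t * x * Complex.I)) (μ.map (fun x => √x)) :=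
    hi id measurable_id _ f1
  have i2 : Integrable (fun x : ℝ => Complex.exp (t * x * Complex.I)) (μ.map (fun x => -√x)) :=
    hi id measurable_id _ f2
  rw [charFun_apply_real, integral_add_measure i1 i2,
    integral_map (by fun_prop) (by fun_prop), integral_map (by fun_prop) (by fun_prop),
    ← integral_add (hi _ (by fun_prop) _ inferInstance)
      (hi (fun x => -√x) (by fun_prop) _ inferInstance)]
  unfold cosT
  rw [← integral_const_mul, ← integral_complex_ofReal]
  congr 1
  ext x
  have hc : Real.cos (|t| * √x) = Real.cos (t * √x) := by
    rcases abs_choice t with h | h <;> rw [h]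
    rw [neg_mul, Real.cos_neg]
  simp only [pow_zero, one_mul, Nat.cast_zero, zero_mul, add_zero, hc]
  push_cast
  rw [Complex.two_cos]
  congr 2
  ring

lemma repr_ext {μ ν : Measure ℝ} {s : ℕ → ℝ} (h : IsStieltjesRepr μ s)
    (h' : IsStieltjesRepr ν s) (hc : ∀ t, 0 ≤ t → cosT μ 0 t = cosT ν 0 t) : μ = ν := by
  have := repr_finite h
  have := repr_finite h'
  have h1 : μ.map (fun x => √x) + μ.map (fun x => -√x) =
      ν.map (fun x => √x) + ν.map (fun x => -√x) := by
    apply Measure.ext_of_charFun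
    ext t
    rw [charFun_symm h, charFun_symm h', hc _ (abs_nonneg t)]
  have key : ∀ ρ : Measure ℝ, IsStieltjesRepr ρ s →
      (ρ.map (fun x => √x) + ρ.map (fun x => -√x)).map (fun y => y ^ 2) = ρ + ρ := by
    intro ρ hρ
    rw [Measure.map_add _ _ (by fun_prop), Measure.map_map (by fun_prop) (by fun_prop),
      Measure.map_map (by fun_prop) (by fun_prop)]
    congr 1
    · conv_rhs => rw [← Measure.map_id (μ := ρ)]
      apply Measure.map_congr
      filter_upwards [repr_ae hρ] with x hx
      simp [Real.sq_sqrt hx]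
    · conv_rhs => rw [← Measure.map_id (μ := ρ)]
      apply Measure.map_congr
      filter_upwards [repr_ae hρ] with x hx
      simp [Real.sq_sqrt hx]
  have h2 : μ + μ = ν + ν := by rw [← key μ h, ← key ν h', h1]
  ext A hA
  have h3 := congrArg (fun ρ : Measure ℝ => ρ A) h2
  simp only [Measure.add_apply, ← two_mul] at h3
  exact (ENNReal.mul_right_inj (by simp) (by simp)).1 h3

lemma moments_pos {μ : Measure ℝ} {s : ℕ → ℝ} (h : IsStieltjesRepr μ s)
    (hcarl : ¬ Summable fun n : ℕ => s (n + 1) ^ (-(1 / (2 * ((n : ℝ) + 1))))) (n : ℕ) :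
    0 < s n := by
  refine lt_of_le_of_ne (mom_nonneg h n) fun h0 => hcarl ?_
  have hz : ∀ m, s (n + m) = 0 := by
    intro m
    induction m with
    | zero => exact h0.symm
    | succ m ih =>
      have := log_convex h (n + m)
      rw [ih, zero_mul] at this
      exact pow_eq_zero_iff (two_ne_zero) |>.1 (le_antisymm this (sq_nonneg _))
  rw [← summable_nat_add_iff n]
  refine summable_zero.congr fun m => ?_
  rw [show m + n + 1 = n + (m + 1) by ring, hz, Real.zero_rpow]
  have : (0 : ℝ) < 1 / (2 * (((m + n : ℕ) : ℝ) + 1)) := by positivity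
  linarith

lemma ratio_not_summable (s : ℕ → ℝ) (hp : ∀ n, 0 < s n)
    (hcarl : ¬ Summable fun n : ℕ => s (n + 1) ^ (-(1 / (2 * ((n : ℝ) + 1))))) :
    ¬ Summable fun n => 1 / √(s (n + 1) / s n) := by
  intro hs
  apply hcarl
  have hb : ∀ n, 0 < 1 / √(s (n + 1) / s n) := fun n => by
    have := div_pos (hp (n + 1)) (hp n); positivity
  have hc := carleman_ineq _ hb hs
  have hprod : ∀ n, ∏ i ∈ Finset.range n, 1 / √(s (i + 1) / s i) = √(s 0 / s n) := by
    intro n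
    induction n with
    | zero => simp [div_self (hp 0).ne']
    | succ n ih =>
      have h0 := hp 0
      have h1 := hp n
      have h2 := hp (n + 1)
      rw [Finset.prod_range_succ, ih, one_div, ← Real.sqrt_inv, ← Real.sqrt_mul (by positivity)]
      congr 1
      field_simp
  refine Summable.of_nonneg_of_le (fun n => Real.rpow_nonneg (hp _).le _) (fun n => ?_)
    (hc.mul_left (max 1 (s 0)⁻¹))
  have h0 := hp 0
  have h2 := hp (n + 1)
  rw [hprod, Real.sqrt_eq_rpow, ← Real.rpow_mul (by positivity)]
  set p : ℝ := 1 / (2 * ((n : ℝ) + 1)) with hpdef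
  have hp0 : 0 ≤ p := by positivity
  have hp1 : p ≤ 1 := by
    rw [hpdef, div_le_one (by positivity)]
    have : (0 : ℝ) ≤ n := by positivity
    linarith
  have e : 1 / 2 * (1 / ((n : ℝ) + 1)) = p := by rw [hpdef]; field_simp
  rw [e]
  have e2 : s (n + 1) ^ (-p) = ((s 0)⁻¹) ^ p * (s 0 / s (n + 1)) ^ p := by
    rw [← Real.mul_rpow (by positivity) (by positivity), Real.rpow_neg h2.le,
      ← Real.inv_rpow h2.le]
    congr 1
    field_simp
  rw [e2]
  gcongr
  calc (s 0)⁻¹ ^ p ≤ (max 1 (s 0)⁻¹) ^ p := by gcongr; exact le_max_right _ _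
    _ ≤ (max 1 (s 0)⁻¹) ^ (1 : ℝ) := Real.rpow_le_rpow_of_exponent_le (le_max_left _ _) hp1
    _ = _ := Real.rpow_one _

/-- Carleman's theorem for the Stieltjes moment problem: the condition
`∑ s_n^{-1/(2n)} = +∞` implies determinacy of the Stieltjes moment sequence. -/
theorem carleman_stieltjes (s : ℕ → ℝ)
    (hmom : ∃ μ : Measure ℝ, IsRadon μ ∧ IsStieltjesRepr μ s)
    (hcarl : ¬ Summable fun n : ℕ => s (n + 1) ^ (-(1 / (2 * ((n : ℝ) + 1))))) :
    ∀ μ ν : Measure ℝ, IsRadon μ → IsRadon ν →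
      IsStieltjesRepr μ s → IsStieltjesRepr ν s → μ = ν := by
  intro μ ν _ _ h h'
  have hp := moments_pos h hcarl
  have hns := ratio_not_summable s hp hcarl
  have hrpos : ∀ n, 0 < √(s (n + 1) / s n) := fun n =>
    Real.sqrt_pos.2 (div_pos (hp (n + 1)) (hp n))
  have hrm : Monotone fun n => √(s (n + 1) / s n) := by
    apply monotone_nat_of_le_succ
    intro n
    apply Real.sqrt_le_sqrt
    rw [div_le_div_iff₀ (hp n) (hp (n + 1))]
    have := log_convex h n
    have e : s (n + 1 + 1) = s (n + 2) := rfl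
    rw [e]
    nlinarith
  refine repr_ext h h' fun t ht => ?_
  have := bang (fun j t => cosT μ j t - cosT ν j t)
    (fun j => 2 * √(s (j / 2) * s ((j + 1) / 2)))
    (fun j => √(s (j / 2 + 1) / s (j / 2)))
    (fun j => by have := Real.sqrt_pos.2 (mul_pos (hp (j / 2)) (hp ((j + 1) / 2))); positivity)
    (fun j => hrpos _)
    (fun i j hij => hrm (Nat.div_le_div_right hij))
    (fun j => by
      have h1 := hp (j / 2)
      have h2 := hp ((j + 1) / 2)
      have h3 := hp (j / 2 + 1)
      rw [show (j + 1 + 1) / 2 = j / 2 + 1 by omega, mul_left_comm, ← Real.sqrt_mul (by positivity)]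
      congr 2
      field_simp)
    (fun j t => (cosT_deriv h j t).sub (cosT_deriv h' j t))
    (fun j t => by
      have h1 := cosT_bound h j t
      have h2 := cosT_bound h' j t
      have h3 := abs_sub (cosT μ j t) (cosT ν j t)
      linarith)
    (fun j => sub_eq_zero.2 (cosT_zero h h' j))
    (fun hs => hns (by
      have := hs.comp_injective (i := fun n : ℕ => 2 * n) (fun a b hab => by
        simp only at hab; omega)
      refine this.congr fun n => ?_
      simp))
    t ht
  exact sub_eq_zero.1 this
end

section
/- Truncated [a,b]-moment problem, even case: Let a, b ∈ ℝ with a < b, let n ∈ ℕ, and let s = (s_j)_{j=0}^{2n} be a real sequence. Then there exists a Radon measure μ on ℝ supported on [a,b] with s_j = ∫_a^b x^j dμ(x) for j = 0,…,2n if and only if both the (n+1)×(n+1) matrix (s_{i+j})_{i,j=0}^n and the n×n matrix ((a+b)s_{i+j+1} − s_{i+j+2} − ab·s_{i+j})_{i,j=0}^{n−1} are positive semidefinite. -/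
open MeasureTheory

open Polynomial in
noncomputable def momL (s : ℕ → ℝ) : ℝ[X] →ₗ[ℝ] ℝ :=
  Polynomial.lsum fun i => s i • LinearMap.id

open Polynomial in
theorem momL_mono (s : ℕ → ℝ) (i : ℕ) (c : ℝ) : momL s (C c * X ^ i) = c * s i := by
  rw [momL, Polynomial.lsum_apply, C_mul_X_pow_eq_monomial, Polynomial.sum_monomial_index]
  · simp [mul_comm]
  · simp

open Polynomial in
theorem momL_quad1 (s : ℕ → ℝ) (n : ℕ) (x : Fin n → ℝ) :
    star x ⬝ᵥ (Matrix.mulVec (Matrix.of fun i j : Fin n => s ((i : ℕ) + (j : ℕ))) x)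
      = momL s ((∑ i : Fin n, C (x i) * X ^ (i : ℕ)) ^ 2) := by
  rw [pow_two, Finset.sum_mul_sum, map_sum]
  simp only [dotProduct, Matrix.mulVec, Finset.mul_sum, map_sum]
  refine Finset.sum_congr rfl fun i _ => Finset.sum_congr rfl fun j _ => ?_
  have : (C (x i) * X ^ (i : ℕ) * (C (x j) * X ^ (j : ℕ)) : ℝ[X])
    = C (x i * x j) * X ^ ((i : ℕ) + (j : ℕ)) := by rw [C_mul, pow_add]; ring
  rw [this, momL_mono]
  simp; ring

open Polynomial in
theorem momL_quad2 (s : ℕ → ℝ) (a b : ℝ) (n : ℕ) (x : Fin n → ℝ) :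
    star x ⬝ᵥ (Matrix.mulVec (Matrix.of fun i j : Fin n =>
       (a + b) * s ((i : ℕ) + (j : ℕ) + 1) - s ((i : ℕ) + (j : ℕ) + 2)
         - a * b * s ((i : ℕ) + (j : ℕ))) x)
      = momL s ((X - C a) * (C b - X) * (∑ i : Fin n, C (x i) * X ^ (i : ℕ)) ^ 2) := by
  rw [pow_two, Finset.sum_mul_sum]
  simp only [dotProduct, Matrix.mulVec, Finset.mul_sum, map_sum]
  refine Finset.sum_congr rfl fun i _ => Finset.sum_congr rfl fun j _ => ?_
  have : ((X - C a) * (C b - X) * (C (x i) * X ^ (i : ℕ) * (C (x j) * X ^ (j : ℕ))) : ℝ[X])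
    = C (x i * x j * (a + b)) * X ^ ((i : ℕ) + (j : ℕ) + 1)
      - C (x i * x j) * X ^ ((i : ℕ) + (j : ℕ) + 2)
      - C (x i * x j * (a * b)) * X ^ ((i : ℕ) + (j : ℕ)) := by
    simp only [C_mul, pow_add, C_add]; ring
  rw [this, map_sub, map_sub, momL_mono, momL_mono, momL_mono]
  simp; ring

open Polynomial in
theorem poly_fin (n : ℕ) (q : ℝ[X]) (h : q.natDegree < n) :
    q = ∑ i : Fin n, C (q.coeff i) * X ^ (i : ℕ) := by
  conv_lhs => rw [q.as_sum_range' n h]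
  rw [Finset.sum_range]
  simp [C_mul_X_pow_eq_monomial]

open Polynomial in
theorem eval_right (r : ℝ[X]) (x b : ℝ) (h : x < b) (H : ∀ y, x < y → y ≤ b → 0 ≤ r.eval y) :
    0 ≤ r.eval x := by
  have h1 : Filter.Tendsto (fun y => r.eval y) (nhdsWithin x (Set.Ioi x)) (nhds (r.eval x)) :=
    (r.continuous.tendsto x).mono_left nhdsWithin_le_nhds
  refine ge_of_tendsto h1 ?_
  filter_upwards [Ioc_mem_nhdsGT h] with y hy using H y hy.1 hy.2

open Polynomial in
theorem eval_left (r : ℝ[X]) (x a : ℝ) (h : a < x) (H : ∀ y, a ≤ y → y < x → 0 ≤ r.eval y) :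
    0 ≤ r.eval x := by
  have h1 : Filter.Tendsto (fun y => r.eval y) (nhdsWithin x (Set.Iio x)) (nhds (r.eval x)) :=
    (r.continuous.tendsto x).mono_left nhdsWithin_le_nhds
  refine ge_of_tendsto h1 ?_
  filter_upwards [Ico_mem_nhdsLT h] with y hy using H y hy.1 hy.2

open Polynomial in
theorem gen_nonneg (L : ℝ[X] →ₗ[ℝ] ℝ) (a b : ℝ) (hab : a < b) (n : ℕ)
    (h1 : ∀ q : ℝ[X], q.natDegree ≤ n → 0 ≤ L (q ^ 2))
    (h2 : ∀ q : ℝ[X], q.natDegree + 1 ≤ n → 0 ≤ L ((X - C a) * (C b - X) * q ^ 2))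
    (i j : ℕ) (q : ℝ[X]) (h : i + j + 2 * q.natDegree ≤ 2 * n) :
    0 ≤ L ((X - C a) ^ i * (C b - X) ^ j * q ^ 2) := by
  have dA : (X - C a : ℝ[X]).natDegree ≤ 1 := (natDegree_X_sub_C a).le
  have dB : (C b - X : ℝ[X]).natDegree ≤ 1 := by
    rw [natDegree_sub]; exact (natDegree_X_sub_C b).le
  have dd : ∀ k l : ℕ, ((X - C a) ^ k * (C b - X) ^ l * q : ℝ[X]).natDegree
      ≤ k + l + q.natDegree := by
    intro k l
    have e1 := natDegree_pow_le_of_le k dA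
    have e2 := natDegree_pow_le_of_le l dB
    have e3 := natDegree_mul_le (p := (X - C a) ^ k) (q := (C b - X) ^ l)
    have e4 := natDegree_mul_le (p := (X - C a) ^ k * (C b - X) ^ l) (q := q)
    omega
  have E : ∀ k l : ℕ, 2 * k + 2 * l + 2 * q.natDegree ≤ 2 * n →
      0 ≤ L ((X - C a) ^ (2 * k) * (C b - X) ^ (2 * l) * q ^ 2) := by
    intro k l hk
    have := h1 ((X - C a) ^ k * (C b - X) ^ l * q) (by have := dd k l; omega)
    convert this using 2; ring
  have O : ∀ k l : ℕ, 2 * k + 1 + (2 * l + 1) + 2 * q.natDegree ≤ 2 * n →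
      0 ≤ L ((X - C a) ^ (2 * k + 1) * (C b - X) ^ (2 * l + 1) * q ^ 2) := by
    intro k l hk
    have := h2 ((X - C a) ^ k * (C b - X) ^ l * q) (by have := dd k l; omega)
    convert this using 2; ring
  have key : L ((X - C a) ^ i * (C b - X) ^ j * q ^ 2) = (b - a)⁻¹ *
      (L ((X - C a) ^ (i + 1) * (C b - X) ^ j * q ^ 2)
        + L ((X - C a) ^ i * (C b - X) ^ (j + 1) * q ^ 2)) := by
    have : (X - C a) ^ (i + 1) * (C b - X) ^ j * q ^ 2 + (X - C a) ^ i * (C b - X) ^ (j + 1) * q ^ 2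
      = (b - a) • ((X - C a) ^ i * (C b - X) ^ j * q ^ 2) := by
      rw [smul_eq_C_mul, C_sub]; ring
    rw [← map_add, this, map_smul, smul_eq_mul, inv_mul_cancel_left₀ (by linarith)]
  have hp : 0 ≤ (b - a)⁻¹ := by rw [inv_nonneg]; linarith
  rcases Nat.even_or_odd' i with ⟨k, rfl | rfl⟩ <;> rcases Nat.even_or_odd' j with ⟨l, rfl | rfl⟩
  · exact E k l (by omega)
  · rw [key]
    exact mul_nonneg hp (add_nonneg (O k l (by omega)) (E k (l + 1) (by omega)))
  · rw [key]
    exact mul_nonneg hp (add_nonneg (E (k + 1) l (by omega)) (O k l (by omega)))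
  · exact O k l (by omega)

open Polynomial in
theorem lukacs (L : ℝ[X] →ₗ[ℝ] ℝ) (a b : ℝ) (hab : a < b) (n : ℕ)
    (h1 : ∀ q : ℝ[X], q.natDegree ≤ n → 0 ≤ L (q ^ 2))
    (h2 : ∀ q : ℝ[X], q.natDegree + 1 ≤ n → 0 ≤ L ((X - C a) * (C b - X) * q ^ 2))
    (d : ℕ) : ∀ (i j : ℕ) (q p : ℝ[X]), i + j + 2 * q.natDegree + d ≤ 2 * n →
    p.natDegree ≤ d → (∀ x, a ≤ x → x ≤ b → 0 ≤ p.eval x) →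
    0 ≤ L ((X - C a) ^ i * (C b - X) ^ j * q ^ 2 * p) := by
  induction d using Nat.strong_induction_on with
  | _ d ih =>
  intro i j q p hd hpd hp
  obtain ⟨x0, hx0, hmin⟩ := isCompact_Icc.exists_isMinOn (Set.nonempty_Icc.2 hab.le)
    (p.continuous.continuousOn (s := Set.Icc a b))
  have hmin' : ∀ x, a ≤ x → x ≤ b → p.eval x0 ≤ p.eval x := fun x h h' => hmin ⟨h, h'⟩
  set c := p.eval x0 with hc
  have hc0 : 0 ≤ c := hp x0 hx0.1 hx0.2
  set r := p /ₘ (X - C x0) with hr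
  have hpr : p = C c + (X - C x0) * r := by
    have := p.modByMonic_add_div (X - C x0)
    rw [modByMonic_X_sub_C_eq_C_eval] at this
    exact this.symm
  have hrd : r.natDegree = p.natDegree - 1 := by
    rw [hr, natDegree_divByMonic _ (monic_X_sub_C x0), natDegree_X_sub_C]
  have hrs : ∀ x, a ≤ x → x ≤ b → 0 ≤ (x - x0) * r.eval x := by
    intro x h h'
    have := hmin' x h h'
    rw [hpr] at this
    simpa using this
  have hgen := gen_nonneg L a b hab n h1 h2 i j q (by omega)
  have hsplit : ∀ t, L ((X - C a) ^ i * (C b - X) ^ j * q ^ 2 * (C c + t))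
      = c * L ((X - C a) ^ i * (C b - X) ^ j * q ^ 2)
        + L ((X - C a) ^ i * (C b - X) ^ j * q ^ 2 * t) := by
    intro t
    rw [mul_add, map_add, mul_comm _ (C c), ← smul_eq_C_mul, map_smul, smul_eq_mul]
  rw [hpr, hsplit]
  refine add_nonneg (mul_nonneg hc0 hgen) ?_
  rcases Nat.eq_zero_or_pos p.natDegree with h0 | hpos
  · have : r = 0 := by
      rw [hr, divByMonic_eq_zero_iff (monic_X_sub_C x0), degree_X_sub_C]
      exact lt_of_le_of_lt degree_le_natDegree (by rw [h0]; norm_num)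
    simp [this]
  rcases eq_or_lt_of_le hx0.1 with ha | ha
  · have hr' : ∀ x, a < x → x ≤ b → 0 ≤ r.eval x := fun x h h' =>
      nonneg_of_mul_nonneg_right (hrs x h.le h') (by linarith)
    have := ih (d - 1) (by omega) (i + 1) j q r (by omega) (by omega) (fun x h h' => by
      rcases eq_or_lt_of_le h with e | e
      · rw [← e]; exact eval_right r a b hab hr'
      · exact hr' x e h')
    refine this.trans_eq (congrArg L ?_); rw [← ha]; ring
  rcases eq_or_lt_of_le hx0.2 with hb | hb
  · have hr' : ∀ x, a ≤ x → x < b → 0 ≤ (-r).eval x := fun x h h' => by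
      have := hrs x h h'.le
      rw [eval_neg]
      refine nonneg_of_mul_nonneg_right (a := x0 - x) (by linarith) (by linarith)
    have := ih (d - 1) (by omega) i (j + 1) q (-r) (by omega) (by rw [natDegree_neg]; omega)
      (fun x h h' => by
      rcases eq_or_lt_of_le h' with e | e
      · rw [e]; exact eval_left (-r) b a hab hr'
      · exact hr' x h e)
    refine this.trans_eq (congrArg L ?_); rw [← hb]; ring
  have hR : ∀ x, x0 < x → x ≤ b → 0 ≤ r.eval x := fun x h h' =>
    nonneg_of_mul_nonneg_right (hrs x (by linarith) h') (by linarith)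
  have hL : ∀ x, a ≤ x → x < x0 → 0 ≤ (-r).eval x := fun x h h' => by
    have := hrs x h (by linarith)
    rw [eval_neg]
    refine nonneg_of_mul_nonneg_right (a := x0 - x) (by linarith) (by linarith)
  have e1 := eval_right r x0 b hb hR
  have e2 := eval_left (-r) x0 a ha hL
  rw [eval_neg] at e2
  have e0 : r.eval x0 = 0 := by linarith
  set t := r /ₘ (X - C x0) with ht
  have hrt : r = (X - C x0) * t := by
    have := r.modByMonic_add_div (X - C x0)
    rw [modByMonic_X_sub_C_eq_C_eval, e0] at this
    simpa using this.symm
  by_cases hr0 : r.natDegree = 0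
  · have : t = 0 := by
      rw [ht, divByMonic_eq_zero_iff (monic_X_sub_C x0), degree_X_sub_C]
      exact lt_of_le_of_lt degree_le_natDegree (by rw [hr0]; norm_num)
    simp [hrt, this]
  have htd : t.natDegree = r.natDegree - 1 := by
    rw [ht, natDegree_divByMonic _ (monic_X_sub_C x0), natDegree_X_sub_C]
  have htR : ∀ x, x0 < x → x ≤ b → 0 ≤ t.eval x := fun x h h' => by
    have := hR x h h'
    rw [hrt] at this
    simp only [eval_mul, eval_sub, eval_X, eval_C] at this
    exact nonneg_of_mul_nonneg_right this (by linarith)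
  have htL : ∀ x, a ≤ x → x < x0 → 0 ≤ t.eval x := fun x h h' => by
    have := hL x h h'
    rw [hrt] at this
    simp only [eval_mul, eval_sub, eval_X, eval_C, eval_neg] at this
    exact nonneg_of_mul_nonneg_right (a := x0 - x) (by linarith) (by linarith)
  have hqd : (q * (X - C x0)).natDegree ≤ q.natDegree + 1 := by
    have := natDegree_mul_le (p := q) (q := X - C x0)
    rwa [natDegree_X_sub_C] at this
  have := ih (d - 2) (by omega) i j (q * (X - C x0)) t (by omega) (by omega)
    (fun x h h' => by
      rcases lt_trichotomy x x0 with e | e | e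
      · exact htL x h e
      · rw [e]; exact eval_right t x0 b hb htR
      · exact htR x e h')
  refine this.trans_eq (congrArg L ?_); rw [hrt]; ring

open Polynomial in
theorem momL_nonneg (a b : ℝ) (hab : a < b) (n : ℕ) (s : ℕ → ℝ)
    (H1 : Matrix.PosSemidef (Matrix.of fun i j : Fin (n + 1) => s ((i : ℕ) + (j : ℕ))))
    (H2 : Matrix.PosSemidef (Matrix.of fun i j : Fin n =>
       (a + b) * s ((i : ℕ) + (j : ℕ) + 1) - s ((i : ℕ) + (j : ℕ) + 2)
         - a * b * s ((i : ℕ) + (j : ℕ)))) (p : ℝ[X]) (hp : p.natDegree ≤ 2 * n)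
    (hpos : ∀ x, a ≤ x → x ≤ b → 0 ≤ p.eval x) : 0 ≤ momL s p := by
  have := lukacs (momL s) a b hab n (fun q hq => by
      have := H1.dotProduct_mulVec_nonneg (fun i => q.coeff i)
      rw [momL_quad1 s, ← poly_fin (n + 1) q (by omega)] at this
      exact this) (fun q hq => by
      have := H2.dotProduct_mulVec_nonneg (fun i => q.coeff i)
      rw [momL_quad2 s, ← poly_fin n q (by omega)] at this
      exact this) (2 * n) 0 0 1 p (by simp) hp hpos
  simpa using this

open Polynomial in
theorem moment_rep (a b : ℝ) (hab : a < b) (m : ℕ) (s : ℕ → ℝ)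
    (H : ∀ p : ℝ[X], p.natDegree ≤ m → (∀ x, a ≤ x → x ≤ b → 0 ≤ p.eval x) → 0 ≤ momL s p) :
    ∃ μ : Measure (Set.Icc a b), IsFiniteMeasure μ ∧
      ∀ j ≤ m, s j = ∫ x : Set.Icc a b, (x : ℝ) ^ j ∂μ := by
  have hs0 : 0 ≤ s 0 := by
    have := H 1 (by simp) (by simp)
    have e := momL_mono s 0 1
    simp only [map_one, pow_zero, one_mul] at e
    rwa [e] at this
  rcases eq_or_lt_of_le hs0 with h0 | h0
  · refine ⟨0, inferInstance, fun j hj => ?_⟩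
    rw [integral_zero_measure]
    obtain ⟨M, hM⟩ := isCompact_Icc.exists_bound_of_continuousOn
      (s := Set.Icc a b) (f := fun x : ℝ => x ^ j) (by fun_prop)
    have hd1 : (C M * X ^ 0 - C 1 * X ^ j : ℝ[X]).natDegree ≤ m := by
      refine (natDegree_sub_le _ _).trans (max_le ?_ ?_)
      · simp
      · exact (natDegree_C_mul_X_pow_le _ _).trans hj
    have hd2 : (C M * X ^ 0 + C 1 * X ^ j : ℝ[X]).natDegree ≤ m := by
      refine (natDegree_add_le _ _).trans (max_le ?_ ?_)
      · simp
      · exact (natDegree_C_mul_X_pow_le _ _).trans hj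
    have e1 := H _ hd1 (fun x h h' => by
      have := abs_le.1 (hM x ⟨h, h'⟩)
      simp; linarith [this.2])
    have e2 := H _ hd2 (fun x h h' => by
      have := abs_le.1 (hM x ⟨h, h'⟩)
      simp; linarith [this.1])
    rw [map_sub, momL_mono, momL_mono, ← h0] at e1
    rw [map_add, momL_mono, momL_mono, ← h0] at e2
    linarith
  let F : ℕ → BoundedContinuousFunction (Set.Icc a b) ℝ := fun j =>
    BoundedContinuousFunction.mkOfCompact ⟨fun x => (x : ℝ) ^ j, by fun_prop⟩
  let Φ : ProbabilityMeasure (Set.Icc a b) → (Fin (m + 1) → ℝ) := fun μ i =>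
    ∫ x, F i x ∂(μ : Measure (Set.Icc a b))
  have hΦ : Continuous Φ := continuous_pi fun i =>
    ProbabilityMeasure.continuous_integral_boundedContinuousFunction (F i)
  have hK : IsClosed (Set.range Φ) := (isCompact_range hΦ).isClosed
  have hconv : Convex ℝ (Set.range Φ) := by
    rintro _ ⟨μ, rfl⟩ _ ⟨ν, rfl⟩ u v hu hv huv
    let ρ : Measure (Set.Icc a b) := ENNReal.ofReal u • (μ : Measure _) + ENNReal.ofReal v • (ν : Measure _)
    have hρ : IsProbabilityMeasure ρ := ⟨by
      simp only [ρ, Measure.add_apply, Measure.smul_apply, measure_univ, smul_eq_mul, mul_one]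
      rw [← ENNReal.ofReal_add hu hv, huv, ENNReal.ofReal_one]⟩
    refine ⟨⟨ρ, hρ⟩, ?_⟩
    ext i
    have i1 := ((F i).integrable (μ : Measure (Set.Icc a b))).smul_measure (ENNReal.ofReal_ne_top (r := u))
    have i2 := ((F i).integrable (ν : Measure (Set.Icc a b))).smul_measure (ENNReal.ofReal_ne_top (r := v))
    simp only [Φ, ProbabilityMeasure.coe_mk, ρ, Pi.add_apply, Pi.smul_apply]
    rw [integral_add_measure i1 i2, integral_smul_measure, integral_smul_measure,
      ENNReal.toReal_ofReal hu, ENNReal.toReal_ofReal hv]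
  have hmem : (fun i : Fin (m + 1) => s i / s 0) ∈ Set.range Φ := by
    by_contra hn
    obtain ⟨f, u, hfu, hf⟩ := geometric_hahn_banach_point_closed hconv hK hn
    have hfe : ∀ v : Fin (m + 1) → ℝ, f v = ∑ i, v i * f (Pi.single i 1) := by
      intro v
      conv_lhs => rw [← Finset.univ_sum_single v]
      rw [map_sum]
      refine Finset.sum_congr rfl fun i _ => ?_
      rw [← smul_eq_mul, ← map_smul, ← Pi.single_smul, smul_eq_mul, mul_one]
    have hd : ((∑ i : Fin (m + 1), C (f (Pi.single i 1)) * X ^ (i : ℕ)) - C u * X ^ 0 : ℝ[X]).natDegree ≤ m := by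
      refine (natDegree_sub_le _ _).trans (max_le ?_ (by simp))
      refine natDegree_sum_le_of_forall_le _ _ fun i _ => ?_
      exact (natDegree_C_mul_X_pow_le _ _).trans (by omega)
    have := H _ hd (fun x h h' => by
      have := hf (Φ ⟨Measure.dirac (⟨x, h, h'⟩ : Set.Icc a b), inferInstance⟩) ⟨_, rfl⟩
      rw [hfe] at this
      simp only [Φ, ProbabilityMeasure.coe_mk, integral_dirac, F,
        BoundedContinuousFunction.mkOfCompact_apply, ContinuousMap.coe_mk] at this
      simp only [eval_sub, eval_finsetSum, eval_mul, eval_C, eval_pow, eval_X, pow_zero, mul_one,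
        mul_comm (f _)]
      linarith)
    rw [map_sub, map_sum] at this
    simp only [momL_mono] at this
    rw [hfe] at hfu
    have e : ∑ i : Fin (m + 1), s i / s 0 * f (Pi.single i 1)
        = (∑ i : Fin (m + 1), f (Pi.single i 1) * s i) / s 0 := by
      rw [Finset.sum_div]
      refine Finset.sum_congr rfl fun i _ => ?_
      ring
    rw [e, div_lt_iff₀ h0] at hfu
    linarith
  obtain ⟨μ, hμ⟩ := hmem
  refine ⟨ENNReal.ofReal (s 0) • (μ : Measure _), Measure.smul_finite _ ENNReal.ofReal_ne_top, fun j hj => ?_⟩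
  have := congrFun hμ ⟨j, by omega⟩
  simp only [Φ, F, BoundedContinuousFunction.mkOfCompact_apply, ContinuousMap.coe_mk] at this
  rw [integral_smul_measure, this, ENNReal.toReal_ofReal hs0, smul_eq_mul]
  field_simp

open Polynomial in
theorem momL_integral (m : ℕ) (s : ℕ → ℝ) (μ : Measure ℝ)
    (h : ∀ j : ℕ, j ≤ m → Integrable (fun x : ℝ => x ^ j) μ ∧ s j = ∫ x : ℝ, x ^ j ∂μ)
    (p : ℝ[X]) (hp : p.natDegree ≤ m) : momL s p = ∫ x, p.eval x ∂μ := by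
  have hp' := poly_fin (m + 1) p (by omega)
  have e : ∀ x, p.eval x = ∑ i : Fin (m + 1), p.coeff i * x ^ (i : ℕ) := by
    intro x
    conv_lhs => rw [hp']
    simp [eval_finsetSum]
  simp only [e]
  rw [integral_finsetSum _ fun (i : Fin (m + 1)) _ => ((h (i : ℕ) (by omega)).1.const_mul _)]
  conv_lhs => rw [hp']
  rw [map_sum]
  refine Finset.sum_congr rfl fun i _ => ?_
  rw [momL_mono, (h i (by omega)).2, integral_const_mul]

/-- Truncated `[a,b]`-moment problem, even case `m = 2n`. -/
theorem truncated_moment_even (a b : ℝ) (hab : a < b) (n : ℕ) (hn : 1 ≤ n) (s : ℕ → ℝ) :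
    (∃ μ : Measure ℝ, IsRadon μ ∧ μ (Set.Icc a b)ᶜ = 0 ∧
      ∀ j : ℕ, j ≤ 2 * n →
        Integrable (fun x : ℝ => x ^ j) μ ∧ s j = ∫ x : ℝ, x ^ j ∂μ) ↔
    (Matrix.PosSemidef (Matrix.of fun i j : Fin (n + 1) => s ((i : ℕ) + (j : ℕ))) ∧
     Matrix.PosSemidef (Matrix.of fun i j : Fin n =>
       (a + b) * s ((i : ℕ) + (j : ℕ) + 1) - s ((i : ℕ) + (j : ℕ) + 2)
         - a * b * s ((i : ℕ) + (j : ℕ)))) := by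
  constructor
  · rintro ⟨μ, -, hsupp, hm⟩
    have hdeg : ∀ (k : ℕ) (x : Fin k → ℝ), (∑ i : Fin k, Polynomial.C (x i) *
        Polynomial.X ^ (i : ℕ)).natDegree ≤ k - 1 := fun k x =>
      Polynomial.natDegree_sum_le_of_forall_le _ _ fun i _ =>
        (Polynomial.natDegree_C_mul_X_pow_le _ _).trans (by omega)
    constructor
    · refine .of_dotProduct_mulVec_nonneg ?_ fun x => ?_
      · ext i j; simp [add_comm]
      · rw [momL_quad1 s, momL_integral (2 * n) s μ hm]
        · refine integral_nonneg fun y => ?_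
          simp only [Polynomial.eval_pow]
          exact sq_nonneg _
        · refine Polynomial.natDegree_pow_le_of_le 2 (hdeg _ x) |>.trans (by omega)
    · refine .of_dotProduct_mulVec_nonneg ?_ fun x => ?_
      · ext i j; simp [add_comm (i : ℕ)]
      · rw [momL_quad2 s, momL_integral (2 * n) s μ hm]
        · refine integral_nonneg_of_ae ?_
          have : ∀ᵐ y ∂μ, y ∈ Set.Icc a b := by
            rw [ae_iff]; exact hsupp
          filter_upwards [this] with y hy
          simp only [Polynomial.eval_pow, Polynomial.eval_mul, Polynomial.eval_sub,
            Polynomial.eval_X, Polynomial.eval_C, Pi.zero_apply]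
          exact mul_nonneg (mul_nonneg (by linarith [hy.1]) (by linarith [hy.2])) (sq_nonneg _)
        · have d1 := Polynomial.natDegree_pow_le_of_le 2 (hdeg _ x)
          have d2 : (Polynomial.X - Polynomial.C a : Polynomial ℝ).natDegree ≤ 1 :=
            (Polynomial.natDegree_X_sub_C a).le
          have d3 : (Polynomial.C b - Polynomial.X : Polynomial ℝ).natDegree ≤ 1 := by
            rw [Polynomial.natDegree_sub]; exact (Polynomial.natDegree_X_sub_C b).le
          exact (Polynomial.natDegree_mul_le_of_le
            (Polynomial.natDegree_mul_le_of_le d2 d3) d1).trans (by omega)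
  · rintro ⟨H1, H2⟩
    obtain ⟨μ, hfin, hμ⟩ := moment_rep a b hab (2 * n) s (momL_nonneg a b hab n s H1 H2)
    have hemb : MeasurableEmbedding (Subtype.val : Set.Icc a b → ℝ) :=
      MeasurableEmbedding.subtype_coe measurableSet_Icc
    refine ⟨μ.map Subtype.val, ⟨inferInstance, inferInstance⟩, ?_, fun j hj => ⟨?_, ?_⟩⟩
    · rw [hemb.map_apply]
      have : (Subtype.val ⁻¹' (Set.Icc a b)ᶜ : Set (Set.Icc a b)) = ∅ := by
        ext x; simp [x.2.1, x.2.2]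
      rw [this, measure_empty]
    · rw [hemb.integrable_map_iff]
      exact (BoundedContinuousFunction.mkOfCompact
        ⟨fun x : Set.Icc a b => (x : ℝ) ^ j, by fun_prop⟩).integrable μ
    · rw [hemb.integral_map]
      exact hμ j hj
end

section
/- Truncated [a,b]-moment problem, odd case: Let a, b ∈ ℝ with a < b, let n ∈ ℕ, and let s = (s_j)_{j=0}^{2n+1} be a real sequence. Then there exists a Radon measure μ on ℝ supported on [a,b] with s_j = ∫_a^b x^j dμ(x) for j = 0,…,2n+1 if and only if both (n+1)×(n+1) matrices (s_{i+j+1} − a·s_{i+j})_{i,j=0}^n and (b·s_{i+j} − s_{i+j+1})_{i,j=0}^n are positive semidefinite. -/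
open MeasureTheory

open Matrix in
lemma real_diag {m : Type*} [Fintype m] [DecidableEq m] {A : Matrix m m ℝ} (hA : A.IsHermitian) :
    ∃ (U : Matrix m m ℝ) (d : m → ℝ), Uᵀ * U = 1 ∧ U * Uᵀ = 1 ∧ A = U * diagonal d * Uᵀ := by
  refine ⟨hA.eigenvectorUnitary, hA.eigenvalues, ?_, ?_, ?_⟩
  · have := Unitary.coe_star_mul_self hA.eigenvectorUnitary
    rwa [star_eq_conjTranspose, conjTranspose_eq_transpose_of_trivial] at this
  · have := Unitary.coe_mul_star_self hA.eigenvectorUnitary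
    rwa [Unitary.coe_star, star_eq_conjTranspose, conjTranspose_eq_transpose_of_trivial] at this
  · have := hA.spectral_theorem
    rw [Unitary.conjStarAlgAut_apply, star_eq_conjTranspose,
      conjTranspose_eq_transpose_of_trivial] at this
    exact this

open Matrix in
lemma diag_nonneg_of {m : Type*} [Fintype m] [DecidableEq m] {A : Matrix m m ℝ}
    (hA : A.PosSemidef) {U : Matrix m m ℝ} {d : m → ℝ} (h : Uᵀ * U = 1)
    (hd : A = U * diagonal d * Uᵀ) (i : m) : 0 ≤ d i := by
  have h1 := hA.conjTranspose_mul_mul_same U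
  have h2 : Uᴴ * A * U = diagonal d := by
    rw [conjTranspose_eq_transpose_of_trivial, hd]
    calc Uᵀ * (U * diagonal d * Uᵀ) * U = (Uᵀ * U) * diagonal d * (Uᵀ * U) := by
          simp only [Matrix.mul_assoc]
      _ = _ := by simp [h]
  rw [h2] at h1
  exact posSemidef_diagonal_iff.1 h1 i

open Matrix in
lemma oconj_mul {m : Type*} [Fintype m] [DecidableEq m] {U : Matrix m m ℝ} (h : Uᵀ * U = 1)
    (d e : m → ℝ) : (U * diagonal d * Uᵀ) * (U * diagonal e * Uᵀ)
      = U * diagonal (fun i => d i * e i) * Uᵀ := by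
  calc (U * diagonal d * Uᵀ) * (U * diagonal e * Uᵀ)
      = U * diagonal d * (Uᵀ * U) * diagonal e * Uᵀ := by simp only [Matrix.mul_assoc]
    _ = _ := by rw [h, Matrix.mul_one, Matrix.mul_assoc U, diagonal_mul_diagonal]

open Matrix in
lemma conj_symm {m : Type*} [Fintype m] [DecidableEq m] (U : Matrix m m ℝ)
    (d : m → ℝ) : (U * diagonal d * Uᵀ)ᵀ = U * diagonal d * Uᵀ := by
  simp [Matrix.transpose_mul, Matrix.mul_assoc]

open Matrix in
lemma exists_pinv {m : Type*} [Fintype m] [DecidableEq m] {H : Matrix m m ℝ}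
    (hH : H.PosSemidef) : ∃ S W : Matrix m m ℝ, Sᵀ = S ∧ Wᵀ = W ∧ S * W = W * S ∧
      S * W * S = S ∧ W * S * W = W ∧ S * S = H := by
  obtain ⟨U, d, h1, h2, h3⟩ := real_diag hH.1
  have hd := diag_nonneg_of hH h1 h3
  refine ⟨U * diagonal (fun i => √(d i)) * Uᵀ, U * diagonal (fun i => (√(d i))⁻¹) * Uᵀ,
    conj_symm _ _, conj_symm _ _, ?_, ?_, ?_, ?_⟩
  · simp only [oconj_mul h1, mul_comm]
  · simp only [oconj_mul h1]
    congr; ext i; exact mul_inv_mul_cancel _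
  · simp only [oconj_mul h1]
    congr; ext i
    have := mul_inv_mul_cancel ((√(d i))⁻¹)
    rwa [inv_inv] at this
  · rw [oconj_mul h1, h3]
    congr; ext i; exact Real.mul_self_sqrt (hd i)

open Matrix in
lemma exists_op {m : Type*} [Fintype m] [DecidableEq m] {a b : ℝ} (hab : a < b)
    {H K : Matrix m m ℝ} (hA : (K - a • H).PosSemidef) (hB : (b • H - K).PosSemidef) :
    ∃ S W T : Matrix m m ℝ, Sᵀ = S ∧ S * S = H ∧ S * T * S = K ∧ W * S * S = S ∧
      W * S * T * S = T * S ∧ (T - a • (1 : Matrix m m ℝ)).PosSemidef ∧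
      (b • (1 : Matrix m m ℝ) - T).PosSemidef := by
  have hba : 0 < b - a := sub_pos.2 hab
  have hsum : (K - a • H) + (b • H - K) = (b - a) • H := by
    rw [sub_smul]; abel
  have hH : H.PosSemidef := by
    have := (hA.add hB).smul (a := (b - a)⁻¹) (by positivity)
    rwa [hsum, smul_smul, inv_mul_cancel₀ hba.ne', one_smul] at this
  obtain ⟨S, W, hS, hW, hc, hSWS, hWSW, hSS⟩ := exists_pinv hH
  set A := K - a • H with hAdef
  set B := b • H - K with hBdef
  have hker : ∀ x, H *ᵥ x = 0 → A *ᵥ x = 0 := by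
    intro x hx
    rw [← hA.dotProduct_mulVec_zero_iff]
    have e : star x ⬝ᵥ (A *ᵥ x) + star x ⬝ᵥ (B *ᵥ x) = 0 := by
      rw [← dotProduct_add, ← add_mulVec, hsum, smul_mulVec, hx]; simp
    have := hA.dotProduct_mulVec_nonneg x
    have := hB.dotProduct_mulVec_nonneg x
    linarith
  have hHP : H * (1 - W * S) = 0 := by
    rw [← hSS, Matrix.mul_sub, Matrix.mul_one, ← hc, Matrix.mul_assoc, hc, ← Matrix.mul_assoc S W S,
      hSWS, sub_self]
  have hAP0 : A * (1 - W * S) = 0 := by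
    ext i j
    have h1 : H *ᵥ ((1 - W * S).col j) = 0 := by
      ext i
      exact congrFun (congrFun hHP i) j
    exact congrFun (hker _ h1) i
  have hAP : A * (W * S) = A := by
    rw [Matrix.mul_sub, Matrix.mul_one, sub_eq_zero] at hAP0
    exact hAP0.symm
  have hAt : Aᵀ = A := by simpa using hA.1.eq
  have hPA : S * W * A = A := by
    have := congrArg transpose hAP
    rwa [transpose_mul, transpose_mul, hS, hW, hAt] at this
  have hWAW : (W * A * W).PosSemidef := by
    have := hA.conjTranspose_mul_mul_same W
    rwa [conjTranspose_eq_transpose_of_trivial, hW] at this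
  have hWBW : (W * B * W).PosSemidef := by
    have := hB.conjTranspose_mul_mul_same W
    rwa [conjTranspose_eq_transpose_of_trivial, hW] at this
  have hPP : (W * S) * (W * S) = W * S := by rw [← Matrix.mul_assoc, hWSW]
  have hPt : (W * S)ᵀ = W * S := by rw [transpose_mul, hS, hW, hc]
  have hQ : (1 - W * S).PosSemidef := by
    have := posSemidef_conjTranspose_mul_self (1 - W * S)
    rw [conjTranspose_eq_transpose_of_trivial, transpose_sub, hPt, transpose_one] at this
    have e : (1 - W * S) * (1 - W * S) = 1 - W * S := by
      rw [Matrix.mul_sub, Matrix.sub_mul, Matrix.sub_mul, hPP]; simp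
    rwa [e] at this
  have hWHW : W * H * W = W * S := by
    rw [← hSS, ← Matrix.mul_assoc W S S, Matrix.mul_assoc, hc, hPP]
  refine ⟨S, W, a • 1 + W * A * W, hS, hSS, ?_, ?_, ?_, ?_, ?_⟩
  · calc S * (a • 1 + W * A * W) * S = a • (S * S) + S * W * A * (W * S) := by
          simp [Matrix.mul_add, Matrix.add_mul, Matrix.mul_assoc]
      _ = K := by rw [hPA, hAP, hSS, hAdef]; abel
  · rw [← hc, hSWS]
  · calc W * S * (a • 1 + W * A * W) * S = a • (W * S * S) + (W * S * W) * A * W * S := by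
          simp [Matrix.mul_add, Matrix.add_mul, Matrix.mul_assoc]
      _ = (a • 1 + W * A * W) * S := by
          rw [hWSW, ← hc, hSWS]; simp [Matrix.add_mul]
  · rwa [add_sub_cancel_left]
  · have e : b • (1 : Matrix m m ℝ) - (a • 1 + W * A * W)
        = (b - a) • (1 - W * S) + W * B * W := by
      have : W * B * W = (b - a) • (W * S) - W * A * W := by
        rw [eq_sub_iff_add_eq, ← hWHW, ← Matrix.add_mul, ← Matrix.mul_add, add_comm B A, hsum]
        simp
      rw [this, smul_sub, sub_smul]; abel
    rw [e]
    exact (hQ.smul hba.le).add hWBW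

lemma forward_aux {μ : Measure ℝ} {n : ℕ} {s : ℕ → ℝ} (α β : ℝ)
    (hs : ∀ j : ℕ, j ≤ 2 * n + 1 →
        Integrable (fun x : ℝ => x ^ j) μ ∧ s j = ∫ x : ℝ, x ^ j ∂μ)
    (h : ∀ᵐ x ∂μ, 0 ≤ α * x + β) :
    Matrix.PosSemidef (Matrix.of fun i j : Fin (n + 1) =>
       α * s ((i : ℕ) + (j : ℕ) + 1) + β * s ((i : ℕ) + (j : ℕ))) := by
  refine Matrix.PosSemidef.of_dotProduct_mulVec_nonneg ?_ ?_
  · ext i j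
    simp [add_comm]
  · intro c
    have hint : ∀ i j : Fin (n + 1), Integrable (fun x : ℝ => c i * ((α * x ^ ((i : ℕ) + j + 1) +
        β * x ^ ((i : ℕ) + j)) * c j)) μ := by
      intro i j
      exact ((((hs _ (by omega)).1.const_mul α).add
        ((hs _ (by omega)).1.const_mul β)).mul_const _).const_mul _
    have key : star c ⬝ᵥ (Matrix.of (fun i j : Fin (n + 1) =>
       α * s ((i : ℕ) + (j : ℕ) + 1) + β * s ((i : ℕ) + (j : ℕ)))).mulVec c
        = ∫ x, ∑ i : Fin (n + 1), ∑ j : Fin (n + 1), c i * ((α * x ^ ((i : ℕ) + j + 1) +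
        β * x ^ ((i : ℕ) + j)) * c j) ∂μ := by
      rw [integral_finsetSum _ fun i _ => integrable_finsetSum _ fun j _ => hint i j]
      simp only [dotProduct, Matrix.mulVec, Pi.star_apply, star_trivial, Matrix.of_apply,
        Finset.mul_sum]
      refine Finset.sum_congr rfl fun i _ => ?_
      rw [integral_finsetSum _ fun j _ => hint i j]
      refine Finset.sum_congr rfl fun j _ => ?_
      rw [integral_const_mul, integral_mul_const,
        integral_add ((hs _ (by omega)).1.const_mul α) ((hs _ (by omega)).1.const_mul β),
        integral_const_mul, integral_const_mul, ← (hs _ (by omega)).2, ← (hs _ (by omega)).2]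
    rw [key]
    refine integral_nonneg_of_ae ?_
    filter_upwards [h] with x hx
    have e : ∑ i : Fin (n + 1), ∑ j : Fin (n + 1), c i * ((α * x ^ ((i : ℕ) + j + 1) +
        β * x ^ ((i : ℕ) + j)) * c j)
        = (α * x + β) * ((∑ i : Fin (n + 1), c i * x ^ (i : ℕ)) *
          (∑ i : Fin (n + 1), c i * x ^ (i : ℕ))) := by
      rw [Finset.sum_mul_sum, Finset.mul_sum]
      refine Finset.sum_congr rfl fun i _ => ?_
      rw [Finset.mul_sum]
      refine Finset.sum_congr rfl fun j _ => ?_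
      ring
    rw [e]
    exact mul_nonneg hx (mul_self_nonneg _)

open Matrix in
lemma oconj_pow {m : Type*} [Fintype m] [DecidableEq m] {U : Matrix m m ℝ} (h : Uᵀ * U = 1)
    (h' : U * Uᵀ = 1)
    (d : m → ℝ) (j : ℕ) : (U * diagonal d * Uᵀ) ^ j = U * diagonal (fun i => d i ^ j) * Uᵀ := by
  induction j with
  | zero => simp [h']
  | succ j ih => rw [pow_succ, ih, oconj_mul h]; simp [pow_succ]

open Matrix in
lemma atoms {a b : ℝ} (hab : a < b) {n : ℕ} {s : ℕ → ℝ}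
    (hA : Matrix.PosSemidef (Matrix.of fun i j : Fin (n + 1) =>
       s ((i : ℕ) + (j : ℕ) + 1) - a * s ((i : ℕ) + (j : ℕ))))
    (hB : Matrix.PosSemidef (Matrix.of fun i j : Fin (n + 1) =>
       b * s ((i : ℕ) + (j : ℕ)) - s ((i : ℕ) + (j : ℕ) + 1))) :
    ∃ d c : Fin (n + 1) → ℝ, (∀ k, d k ∈ Set.Icc a b) ∧
      ∀ j ≤ 2 * n + 1, s j = ∑ k, c k ^ 2 * d k ^ j := by
  set H : Matrix (Fin (n + 1)) (Fin (n + 1)) ℝ := Matrix.of fun i j => s ((i : ℕ) + (j : ℕ)) with hH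
  set K : Matrix (Fin (n + 1)) (Fin (n + 1)) ℝ :=
    Matrix.of fun i j => s ((i : ℕ) + (j : ℕ) + 1) with hK
  obtain ⟨S, W, T, hS, hSS, hSTS, hWSS, hWSTS, hTa, hTb⟩ :=
    exists_op (H := H) (K := K) hab hA hB
  have hT : T.IsHermitian := by
    have := hTa.1.add (isHermitian_one.smul (k := a) (IsSelfAdjoint.all a))
    rwa [sub_add_cancel] at this
  have hTt : Tᵀ = T := by simpa using hT.eq
  obtain ⟨U, d, h1, h2, h3⟩ := real_diag hT
  have hstep : ∀ i : ℕ, ∀ hi : i + 1 < n + 1, (T * S) *ᵥ Pi.single ⟨i, by omega⟩ 1 =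
      S *ᵥ Pi.single ⟨i + 1, hi⟩ 1 := by
    intro i hi
    have e : K *ᵥ Pi.single ⟨i, by omega⟩ 1 = H *ᵥ Pi.single ⟨i + 1, hi⟩ 1 := by
      ext k
      simp [hH, hK, add_assoc]
    calc (T * S) *ᵥ Pi.single ⟨i, by omega⟩ 1
        = (W * (S * T * S)) *ᵥ Pi.single ⟨i, by omega⟩ 1 := by
          rw [← hWSTS]; simp only [Matrix.mul_assoc]
      _ = (W * (S * S)) *ᵥ Pi.single ⟨i + 1, hi⟩ 1 := by
          rw [hSTS, hSS, ← mulVec_mulVec, e, mulVec_mulVec]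
      _ = _ := by rw [← Matrix.mul_assoc, hWSS]
  have hpow : ∀ i : ℕ, ∀ hi : i < n + 1, (T ^ i * S) *ᵥ Pi.single 0 1 =
      S *ᵥ Pi.single ⟨i, hi⟩ 1 := by
    intro i
    induction i with
    | zero => intro hi; simp
    | succ i ih =>
      intro hi
      rw [← hstep i hi, ← mulVec_mulVec _ T S, ← ih (by omega), mulVec_mulVec, ← Matrix.mul_assoc,
        pow_succ']
  have hgen : ∀ i k : ℕ, ∀ hi : i < n + 1, ∀ hk : k < n + 1, ∀ M : Matrix (Fin (n + 1)) (Fin (n + 1)) ℝ,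
      (S * T ^ i * M * T ^ k * S) 0 0 = (S * M * S) ⟨i, hi⟩ ⟨k, hk⟩ := by
    intro i k hi hk M
    have col : ∀ (X Y : Matrix (Fin (n+1)) (Fin (n+1)) ℝ) (p q : Fin (n+1)),
        (Xᵀ * M * Y) p q = (X *ᵥ Pi.single p 1) ⬝ᵥ (M *ᵥ (Y *ᵥ Pi.single q 1)) := by
      intro X Y p q
      rw [mulVec_mulVec, Matrix.mul_assoc]
      simp [Matrix.mul_apply, dotProduct]
    have e1 : S * T ^ i * M * T ^ k * S = (T ^ i * S)ᵀ * M * (T ^ k * S) := by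
      rw [transpose_mul, transpose_pow, hTt, hS]; simp only [Matrix.mul_assoc]
    have e2 : S * M * S = Sᵀ * M * S := by rw [hS]
    rw [e1, e2, col, col, hpow i hi, hpow k hk]
  have hmom : ∀ j ≤ 2 * n + 1, s j = (S * T ^ j * S) 0 0 := by
    intro j hj
    rcases Nat.lt_or_ge j (2 * n + 1) with h | h
    · obtain ⟨i, k, hi, hk, rfl⟩ : ∃ i k, i < n + 1 ∧ k < n + 1 ∧ j = i + k :=
        ⟨min j n, j - min j n, by omega, by omega, by omega⟩
      have := hgen i k hi hk 1
      rw [Matrix.mul_one, Matrix.mul_one, hSS, Matrix.mul_assoc S, ← pow_add] at this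
      rw [this]; simp [hH]
    · obtain rfl : j = 2 * n + 1 := by omega
      have := hgen n n (by omega) (by omega) T
      rw [hSTS, Matrix.mul_assoc S, Matrix.mul_assoc S, ← pow_succ, ← pow_add] at this
      rw [show 2 * n + 1 = n + 1 + n by ring, this]; simp [hK]; congr 1; omega
  have hcomb : ∀ x y : ℝ, x • T + y • (1 : Matrix _ _ ℝ) =
      U * diagonal (fun i => x * d i + y) * Uᵀ := by
    intro x y
    have : diagonal (fun i => x * d i + y) = x • diagonal d + y • (1 : Matrix _ _ ℝ) := by
      ext i j
      by_cases hij : i = j <;> simp [hij, diagonal, Matrix.one_apply]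
    rw [this, Matrix.mul_add, Matrix.add_mul, h3]
    simp [h2]
  refine ⟨d, fun k => (Uᵀ * S) k 0, fun k => ⟨?_, ?_⟩, fun j hj => ?_⟩
  · have := diag_nonneg_of hTa h1 (d := fun i => 1 * d i + (-a)) (by
      rw [← hcomb]; simp [sub_eq_add_neg]) k
    linarith
  · have := diag_nonneg_of hTb h1 (d := fun i => (-1) * d i + b) (by
      rw [← hcomb]; simp [sub_eq_add_neg, add_comm]) k
    linarith
  · rw [hmom j hj, h3, oconj_pow h1 h2]
    have e : S * (U * diagonal (fun i => d i ^ j) * Uᵀ) * S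
        = (Uᵀ * S)ᵀ * (diagonal (fun i => d i ^ j) * (Uᵀ * S)) := by
      rw [transpose_mul, transpose_transpose, hS]; simp only [Matrix.mul_assoc]
    rw [e, Matrix.mul_apply]
    refine Finset.sum_congr rfl fun k _ => ?_
    rw [diagonal_mul, transpose_apply]; ring

/-- Truncated `[a,b]`-moment problem, odd case `m = 2n+1`. -/
theorem truncated_moment_odd (a b : ℝ) (hab : a < b) (n : ℕ) (hn : 1 ≤ n) (s : ℕ → ℝ) :
    (∃ μ : Measure ℝ, IsRadon μ ∧ μ (Set.Icc a b)ᶜ = 0 ∧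
      ∀ j : ℕ, j ≤ 2 * n + 1 →
        Integrable (fun x : ℝ => x ^ j) μ ∧ s j = ∫ x : ℝ, x ^ j ∂μ) ↔
    (Matrix.PosSemidef (Matrix.of fun i j : Fin (n + 1) =>
       s ((i : ℕ) + (j : ℕ) + 1) - a * s ((i : ℕ) + (j : ℕ))) ∧
     Matrix.PosSemidef (Matrix.of fun i j : Fin (n + 1) =>
       b * s ((i : ℕ) + (j : ℕ)) - s ((i : ℕ) + (j : ℕ) + 1))) := by
  constructor
  · rintro ⟨μ, -, hμ, hs⟩
    have hae : ∀ᵐ x ∂μ, x ∈ Set.Icc a b := hμ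
    constructor
    · have := forward_aux 1 (-a) hs (by
        filter_upwards [hae] with x hx
        linarith [hx.1])
      convert this using 4
      ring
    · have := forward_aux (-1) b hs (by
        filter_upwards [hae] with x hx
        linarith [hx.2])
      convert this using 4
      ring
  · rintro ⟨hA, hB⟩
    obtain ⟨d, c, hd, hs⟩ := atoms hab hA hB
    let μ : Measure ℝ := ∑ k, ENNReal.ofReal (c k ^ 2) • Measure.dirac (d k)
    have hfin : IsFiniteMeasure μ := by
      refine ⟨?_⟩
      simp [μ, ENNReal.sum_lt_top]
    have hi : ∀ j : ℕ, ∀ k, Integrable (fun x : ℝ => x ^ j)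
        (ENNReal.ofReal (c k ^ 2) • Measure.dirac (d k)) := fun j k =>
      (integrable_dirac (by simp)).smul_measure ENNReal.ofReal_ne_top
    refine ⟨μ, ⟨inferInstance, inferInstance⟩, ?_, fun j hj => ⟨?_, ?_⟩⟩
    · simp only [μ, Measure.finsetSum_apply, Measure.smul_apply]
      refine Finset.sum_eq_zero fun k _ => ?_
      rw [Measure.dirac_apply' _ measurableSet_Icc.compl]
      simp [(hd k).1, (hd k).2]
    · exact integrable_finsetSum_measure.2 fun k _ => hi j k
    · rw [integral_finsetSum_measure fun k _ => hi j k, hs j hj]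
      refine Finset.sum_congr rfl fun k _ => ?_
      rw [integral_smul_measure, integral_dirac, ENNReal.toReal_ofReal (sq_nonneg _), smul_eq_mul]
end
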